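/- arXiv:1308.4390 — 3 statements merged into one kernel-verified Lean document; each statement's English description precedes it below -/
import Mathlib

section
/- Let g be a symmetric invertible 4×4 real matrix with det g < 0 and let W have Weyl symmetries with respect to g. Then for all a,b,c,h in Fin 4: (1/4) Σ_{p,q,r,s,u,v,d} η^{pqr}{}_s η^{suv}{}_h W_{pqda} g_{rb} W_{uv}{}^{d}{}_c = − Σ_{e,f} W_{afhe} W_b{}^{e}{}_c{}^{f} + (1/8) g_{hb} g_{ac} Σ W_{defg} W^{defg}. (This is the component form of the identity *(*(W_{da}∧θ_b)∧W^{d}{}_c) = −θ^{d} W_{afde} W_b{}^{e}{}_c{}^{f} + (1/8) θ_b g_{ac} W_{defh} W^{defh}.) -/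
open Finset

/-- The Levi-Civita alternating symbol on `Fin 4`: the sign of `(a,b,c,d)` as a
permutation of `(0,1,2,3)`, and `0` if two indices coincide. -/
noncomputable def eps4 (a b c d : Fin 4) : ℝ :=
  (((b : ℕ) : ℝ) - ((a : ℕ) : ℝ)) * (((c : ℕ) : ℝ) - ((a : ℕ) : ℝ)) *
    (((d : ℕ) : ℝ) - ((a : ℕ) : ℝ)) * (((c : ℕ) : ℝ) - ((b : ℕ) : ℝ)) *
    (((d : ℕ) : ℝ) - ((b : ℕ) : ℝ)) * (((d : ℕ) : ℝ) - ((c : ℕ) : ℝ)) / 12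

/-- The volume element `η_{abcd} = √(−det g)·ε_{abcd}`. -/
noncomputable def eta4 (g : Fin 4 → Fin 4 → ℝ) (a b c d : Fin 4) : ℝ :=
  Real.sqrt (-(Matrix.of g).det) * eps4 a b c d

/-- `η^{pqr}{}_s`, obtained by raising the first three indices of `η` with `g^{ab}`. -/
noncomputable def etaUp3 (g ginv : Fin 4 → Fin 4 → ℝ) (p q r s : Fin 4) : ℝ :=
  ∑ a, ∑ b, ∑ c, ginv p a * ginv q b * ginv r c * eta4 g a b c s

theorem sum_eps4_eq_det (u v w x : Fin 4 → ℝ) :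
    ∑ a, ∑ b, ∑ c, ∑ d, eps4 a b c d * u a * v b * w c * x d
      = (Matrix.of ![u, v, w, x]).det := by
  rw [Matrix.det_succ_row_zero]
  simp [Matrix.det_fin_three, Fin.sum_univ_four, eps4, Fin.succAbove]
  ring

theorem sum_eps4_row (M : Matrix (Fin 4) (Fin 4) ℝ) (p q r s : Fin 4) :
    ∑ a, ∑ b, ∑ c, ∑ d, eps4 a b c d * M p a * M q b * M r c * M s d
      = M.det * eps4 p q r s := by
  have hP : (Matrix.of ![Pi.single p 1, Pi.single q 1, Pi.single r 1, Pi.single s (1 : ℝ)]).det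
      = eps4 p q r s := by
    rw [← sum_eps4_eq_det]
    simp [Pi.single_apply]
  rw [sum_eps4_eq_det, mul_comm, ← hP, ← Matrix.det_mul]
  congr 1
  ext i j
  fin_cases i <;> simp [Matrix.mul_apply, Pi.single_apply]

set_option maxHeartbeats 1000000 in
theorem sum_eps4_mul_eps4 (A B : Fin 4 → Fin 4 → ℝ)
    (hA : ∀ a b, A a b = -A b a) (hB : ∀ a b, B a b = -B b a) (r h : Fin 4) :
    ∑ t, (∑ p, ∑ q, eps4 p q r t * A p q) * (∑ x, ∑ y, eps4 t x y h * B x y)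
      = -(2 * (if r = h then ∑ p, ∑ q, A p q * B p q else 0) + 4 * ∑ x, A h x * B x r) := by
  have hA0 : ∀ a, A a a = 0 := fun a => by linarith [hA a a]
  have hB0 : ∀ a, B a a = 0 := fun a => by linarith [hB a a]
  have a1 := hA 1 0
  have a2 := hA 2 0
  have a3 := hA 3 0
  have a4 := hA 2 1
  have a5 := hA 3 1
  have a6 := hA 3 2
  have b1 := hB 1 0
  have b2 := hB 2 0
  have b3 := hB 3 0
  have b4 := hB 2 1
  have b5 := hB 3 1
  have b6 := hB 3 2
  fin_cases r <;> fin_cases h <;>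
    simp [Fin.sum_univ_four, eps4, hA0, hB0, a1, a2, a3, a4, a5, a6, b1, b2, b3, b4, b5, b6] <;>
    ring

set_option maxHeartbeats 1000000 in
theorem traceless_contraction (V : Fin 4 → Fin 4 → Fin 4 → Fin 4 → ℝ)
    (h1 : ∀ a b c d, V a b c d = -V b a c d) (h2 : ∀ a b c d, V a b c d = -V a b d c)
    (htr : ∀ b d, ∑ a, V a b a d = 0) (a c : Fin 4) :
    ∑ p, ∑ q, ∑ d, V p q d a * V d c p q
      = (1 / 4) * (if c = a then ∑ p, ∑ q, ∑ r, ∑ s, V p q r s * V r s p q else 0) := by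
  have h10 : ∀ a c d, V a a c d = 0 := fun a c d => by linarith [h1 a a c d]
  have h20 : ∀ a b c, V a b c c = 0 := fun a b c => by linarith [h2 a b c c]
  have a1 := h1 1 0
  have a2 := h1 2 0
  have a3 := h1 3 0
  have a4 := h1 2 1
  have a5 := h1 3 1
  have a6 := h1 3 2
  have b1 := fun a b => h2 a b 1 0
  have b2 := fun a b => h2 a b 2 0
  have b3 := fun a b => h2 a b 3 0
  have b4 := fun a b => h2 a b 2 1
  have b5 := fun a b => h2 a b 3 1
  have b6 := fun a b => h2 a b 3 2
  simp only [Fin.sum_univ_four] at htr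
  have t00 := htr 0 0
  have t11 := htr 1 1
  have t22 := htr 2 2
  have t33 := htr 3 3
  have t01 := htr 0 1
  have t02 := htr 0 2
  have t03 := htr 0 3
  have t10 := htr 1 0
  have t12 := htr 1 2
  have t13 := htr 1 3
  have t20 := htr 2 0
  have t21 := htr 2 1
  have t23 := htr 2 3
  have t30 := htr 3 0
  have t31 := htr 3 1
  have t32 := htr 3 2
  simp only [h10, h20, a1, a2, a3, a4, a5, a6, b1, b2, b3, b4, b5, b6, neg_neg, zero_add,
    add_zero] at t00 t01 t02 t03 t10 t11 t12 t13 t20 t21 t22 t23 t30 t31 t32 t33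
  have e1 : V 2 3 2 3 = V 0 1 0 1 := by linarith
  have e2 : V 1 3 1 3 = V 0 2 0 2 := by linarith
  have e3 : V 1 2 1 2 = -V 0 1 0 1 - V 0 2 0 2 := by linarith
  have e4 : V 0 3 0 3 = -V 0 1 0 1 - V 0 2 0 2 := by linarith
  have e5 : V 0 3 1 3 = -V 0 2 1 2 := by linarith
  have e6 : V 0 3 2 3 = V 0 1 1 2 := by linarith
  have e7 : V 0 2 2 3 = -V 0 1 1 3 := by linarith
  have e8 : V 1 3 0 3 = -V 1 2 0 2 := by linarith
  have e9 : V 1 3 2 3 = -V 0 1 0 2 := by linarith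
  have e10 : V 1 2 2 3 = V 0 1 0 3 := by linarith
  have e11 : V 2 3 0 3 = V 1 2 0 1 := by linarith
  have e12 : V 2 3 1 3 = -V 0 2 0 1 := by linarith
  have e13 : V 1 2 1 3 = -V 0 2 0 3 := by linarith
  have e14 : V 2 3 0 2 = -V 1 3 0 1 := by linarith
  have e15 : V 2 3 1 2 = V 0 3 0 1 := by linarith
  have e16 : V 1 3 1 2 = -V 0 3 0 2 := by linarith
  fin_cases a <;> fin_cases c <;>
    simp [Fin.sum_univ_four, h10, h20, a1, a2, a3, a4, a5, a6, b1, b2, b3, b4, b5, b6,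
      e1, e2, e3, e4, e5, e6, e7, e8, e9, e10, e11, e12, e13, e14, e15, e16] <;>
    ring

theorem symm_of_left_inverse {g ginv : Fin 4 → Fin 4 → ℝ} (hg : ∀ a b, g a b = g b a)
    (hginv : ∀ a b, ∑ c, ginv a c * g c b = if a = b then (1 : ℝ) else 0) (a b : Fin 4) :
    ginv a b = ginv b a := by
  have h1 : Matrix.of ginv * Matrix.of g = 1 := by
    ext i j
    simp [Matrix.mul_apply, hginv, Matrix.one_apply]
  have hgT : (Matrix.of g).transpose = Matrix.of g := by
    ext i j
    simp [hg i j]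
  have h2 : Matrix.of g * (Matrix.of ginv).transpose = 1 := by
    rw [← Matrix.transpose_one, ← h1, Matrix.transpose_mul, hgT]
  have h3 := left_inv_eq_right_inv h1 h2
  exact congrFun (congrFun h3 a) b

theorem sum_move_third {ι : Type*} [Fintype ι] {f : ι → ι → ι → ℝ} :
    ∑ a, ∑ b, ∑ c, f a b c = ∑ c, ∑ a, ∑ b, f a b c := by
  rw [Finset.sum_congr rfl fun a _ => Finset.sum_comm, Finset.sum_comm]

theorem sum_pair_comm {ι : Type*} [Fintype ι] {f : ι → ι → ι → ι → ℝ} :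
    ∑ a, ∑ b, ∑ c, ∑ d, f a b c d = ∑ c, ∑ d, ∑ a, ∑ b, f a b c d := by
  rw [sum_move_third]
  refine sum_congr rfl fun c _ => ?_
  rw [sum_move_third]

theorem sum_seven_reorder {ι : Type*} [Fintype ι] (E F : ι → ι → ι → ι → ℝ)
    (A Y : ι → ι → ι → ℝ) (k : ι → ℝ) (h : ι) :
    ∑ p, ∑ q, ∑ r, ∑ s, ∑ u, ∑ v, ∑ d, E p q r s * F s u v h * A p q d * k r * Y d u v
      = ∑ d, ∑ r, k r * ∑ s, (∑ p, ∑ q, E p q r s * A p q d) *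
          (∑ u, ∑ v, F s u v h * Y d u v) := by
  rw [sum_pair_comm, Finset.sum_comm (f := fun d r => k r * _)]
  refine sum_congr rfl fun r _ => ?_
  simp only [Finset.mul_sum univ _ (k r)]
  rw [Finset.sum_comm (f := fun d s => k r * _)]
  refine sum_congr rfl fun s _ => ?_
  rw [Finset.sum_congr rfl fun p _ => Finset.sum_congr rfl fun q _ => sum_move_third,
    sum_move_third]
  refine sum_congr rfl fun d _ => ?_
  simp only [Finset.sum_mul, Finset.mul_sum]
  rw [sum_pair_comm]
  refine sum_congr rfl fun _ _ => sum_congr rfl fun _ _ => sum_congr rfl fun _ _ =>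
    sum_congr rfl fun _ _ => ?_
  ring

theorem sum_raise_mul {ι : Type*} [Fintype ι] (G X Y : ι → ι → ℝ) :
    ∑ p, ∑ q, (∑ u, ∑ v, G p u * G q v * X u v) * Y p q
      = ∑ p, ∑ q, X p q * ∑ u, ∑ v, G u p * G v q * Y u v := by
  simp only [Finset.sum_mul, Finset.mul_sum]
  rw [sum_pair_comm]
  refine sum_congr rfl fun p _ => sum_congr rfl fun q _ => sum_congr rfl fun u _ =>
    sum_congr rfl fun v _ => ?_
  ring

theorem sum_mul_smul_sum {ι : Type*} [Fintype ι] (α γ : ι → ℝ) (G : ι → ι → ℝ) (k : ℝ) :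
    ∑ s, α s * (k * ∑ t, G s t * γ t) = k * ∑ t, (∑ s, α s * G s t) * γ t := by
  simp only [Finset.sum_mul, Finset.mul_sum]
  rw [Finset.sum_comm]
  exact sum_congr rfl fun t _ => sum_congr rfl fun s _ => by ring

theorem sum_etaUp3_mul (g ginv : Fin 4 → Fin 4 → ℝ) (hs : ∀ a b, ginv a b = ginv b a)
    (p q r t : Fin 4) :
    ∑ s, etaUp3 g ginv p q r s * ginv s t
      = √(-(Matrix.of g).det) * ((Matrix.of ginv).det * eps4 p q r t) := by
  rw [← sum_eps4_row, Finset.mul_sum]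
  simp only [etaUp3, eta4, Finset.sum_mul, Finset.mul_sum, Matrix.of_apply]
  rw [Finset.sum_comm]
  refine sum_congr rfl fun a _ => ?_
  rw [Finset.sum_comm]
  refine sum_congr rfl fun b _ => ?_
  rw [Finset.sum_comm]
  refine sum_congr rfl fun c _ => sum_congr rfl fun d _ => ?_
  rw [hs d t]
  ring

theorem sum_etaUp3_contract (g ginv C : Fin 4 → Fin 4 → ℝ) (s h : Fin 4) :
    ∑ u, ∑ v, etaUp3 g ginv s u v h * C u v
      = √(-(Matrix.of g).det) * ∑ t, ginv s t *
          ∑ x, ∑ y, eps4 t x y h * ∑ u, ∑ v, ginv u x * ginv v y * C u v := by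
  simp only [etaUp3, eta4, Finset.sum_mul, Finset.mul_sum]
  rw [sum_move_third]
  refine sum_congr rfl fun t _ => ?_
  rw [sum_move_third]
  refine sum_congr rfl fun x _ => ?_
  rw [sum_move_third]
  refine sum_congr rfl fun y _ => sum_congr rfl fun u _ => sum_congr rfl fun v _ => ?_
  ring

theorem sum_etaUp3_mul_etaUp3 (g ginv A C : Fin 4 → Fin 4 → ℝ)
    (hg : ∀ a b, g a b = g b a)
    (hginv : ∀ a b, ∑ c, ginv a c * g c b = if a = b then (1 : ℝ) else 0)
    (hdet : (Matrix.of g).det < 0)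
    (hA : ∀ a b, A a b = -A b a) (hC : ∀ a b, C a b = -C b a) (r h : Fin 4) :
    ∑ s, (∑ p, ∑ q, etaUp3 g ginv p q r s * A p q) * (∑ u, ∑ v, etaUp3 g ginv s u v h * C u v)
      = 2 * (if r = h then
          ∑ p, ∑ q, A p q * (∑ u, ∑ v, ginv u p * ginv v q * C u v) else 0)
        + 4 * ∑ x, A h x * (∑ u, ∑ v, ginv u x * ginv v r * C u v) := by
  have hs := symm_of_left_inverse hg hginv
  have h1 : (Matrix.of ginv).det * (Matrix.of g).det = 1 := by
    rw [← Matrix.det_mul, ← Matrix.det_one (n := Fin 4)]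
    congr 1
    ext i j
    simp [Matrix.mul_apply, hginv, Matrix.one_apply]
  have h2 : √(-(Matrix.of g).det) * √(-(Matrix.of g).det) = -(Matrix.of g).det :=
    Real.mul_self_sqrt (by linarith)
  have hB : ∀ x y, (∑ u, ∑ v, ginv u x * ginv v y * C u v)
      = -(∑ u, ∑ v, ginv u y * ginv v x * C u v) := by
    intro x y
    rw [Finset.sum_comm]
    simp only [← Finset.sum_neg_distrib]
    refine sum_congr rfl fun u _ => sum_congr rfl fun v _ => ?_
    rw [hC]
    ring
  have key := sum_eps4_mul_eps4 A _ hA hB r h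
  rw [eq_neg_iff_add_eq_zero, add_comm, ← eq_neg_iff_add_eq_zero] at key
  rw [key]
  simp only [sum_etaUp3_contract]
  set γ : Fin 4 → ℝ := fun t =>
    ∑ x, ∑ y, eps4 t x y h * ∑ u, ∑ v, ginv u x * ginv v y * C u v with hγ
  have hα : ∀ t, ∑ s, (∑ p, ∑ q, etaUp3 g ginv p q r s * A p q) * ginv s t
      = √(-(Matrix.of g).det) * (Matrix.of ginv).det * ∑ p, ∑ q, eps4 p q r t * A p q := by
    intro t
    simp only [Finset.sum_mul, Finset.mul_sum]
    rw [Finset.sum_comm]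
    refine sum_congr rfl fun p _ => ?_
    rw [Finset.sum_comm]
    refine sum_congr rfl fun q _ => ?_
    have := congrArg (· * A p q) (sum_etaUp3_mul g ginv hs p q r t)
    simp only [Finset.sum_mul] at this
    rw [← mul_assoc, mul_assoc _ _ (eps4 _ _ _ _), ← this]
    exact sum_congr rfl fun s _ => by ring
  calc _ = √(-(Matrix.of g).det) * ∑ t,
        (∑ s, (∑ p, ∑ q, etaUp3 g ginv p q r s * A p q) * ginv s t) * γ t := by
        exact sum_mul_smul_sum _ γ ginv _
    _ = _ := by
        simp only [hα, Finset.mul_sum univ (fun t => _ * γ t), ← Finset.sum_neg_distrib]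
        refine sum_congr rfl fun t _ => ?_
        linear_combination ((∑ p, ∑ q, eps4 p q r t * A p q) * γ t) *
          ((Matrix.of ginv).det * h2 - h1)

theorem weyl_contraction (g ginv : Fin 4 → Fin 4 → ℝ)
    (hg : ∀ a b, g a b = g b a)
    (hginv : ∀ a b, ∑ c, ginv a c * g c b = if a = b then (1 : ℝ) else 0)
    (W : Fin 4 → Fin 4 → Fin 4 → Fin 4 → ℝ)
    (hW1 : ∀ a b c d, W a b c d = - W b a c d)
    (hW2 : ∀ a b c d, W a b c d = - W a b d c)
    (hW3 : ∀ a b c d, W a b c d = W c d a b)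
    (hWtr : ∀ b d, ∑ a, ∑ c, ginv a c * W a b c d = 0) (a c : Fin 4) :
    ∑ d, ∑ p, ∑ q, W p q d a * (∑ u, ∑ v, ginv u p * ginv v q * ∑ m, ginv d m * W u v m c)
      = (1 / 4) * g a c * (∑ d, ∑ e, ∑ f, ∑ k, W d e f k *
              (∑ p, ∑ q, ∑ r, ∑ s,
                ginv d p * ginv e q * ginv f r * ginv k s * W p q r s)) := by
  have hs := symm_of_left_inverse hg hginv
  let V : Fin 4 → Fin 4 → Fin 4 → Fin 4 → ℝ := fun i j k l =>
    ∑ u, ∑ v, ginv i u * ginv j v * W u v k l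
  have h1 : ∀ i j k l, V i j k l = -V j i k l := by
    intro i j k l
    simp only [V, ← Finset.sum_neg_distrib]
    rw [Finset.sum_comm]
    refine sum_congr rfl fun u _ => sum_congr rfl fun v _ => ?_
    rw [hW1]
    ring
  have h2 : ∀ i j k l, V i j k l = -V i j l k := by
    intro i j k l
    simp only [V, ← Finset.sum_neg_distrib]
    refine sum_congr rfl fun u _ => sum_congr rfl fun v _ => ?_
    rw [hW2]
    ring
  have htr : ∀ b d, ∑ a, V a b a d = 0 := by
    intro b d
    have : ∑ v, ginv b v * ∑ a, ∑ c, ginv a c * W a v c d = 0 := by simp [hWtr]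
    rw [← this]
    simp only [V, Finset.mul_sum]
    rw [sum_move_third]
    refine sum_congr rfl fun v _ => ?_
    rw [Finset.sum_comm]
    refine sum_congr rfl fun i _ => sum_congr rfl fun j _ => ?_
    rw [hs j i]
    ring
  have hlow : ∀ d p q, ∑ e, V d e p q * g e c = ∑ m, ginv d m * W p q m c := by
    intro d p q
    have (u : Fin 4) : ∑ v, (∑ e, ginv v e * g e c) * (ginv d u * W u v p q)
        = ginv d u * W p q u c := by
      simp [hginv, hW3 u c]
    simp only [← this, V, Finset.sum_mul]
    rw [Finset.sum_comm]
    refine sum_congr rfl fun u _ => ?_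
    rw [Finset.sum_comm]
    refine sum_congr rfl fun v _ => sum_congr rfl fun e _ => ?_
    rw [hs v e]
    ring
  have key := traceless_contraction V h1 h2 htr a
  calc _ = ∑ e, (∑ p, ∑ q, ∑ d, V p q d a * V d e p q) * g e c := by
        have : ∀ p q d, ∑ e, V p q d a * (V d e p q * g e c)
            = V p q d a * ∑ m, ginv d m * W p q m c := by
          intro p q d
          rw [← hlow, Finset.mul_sum]
        have hr : ∑ e, (∑ p, ∑ q, ∑ d, V p q d a * V d e p q) * g e c
            = ∑ d, ∑ p, ∑ q, V p q d a * ∑ m, ginv d m * W p q m c := by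
          simp only [← this, Finset.sum_mul, mul_assoc]
          rw [Finset.sum_congr rfl fun e _ => sum_move_third, Finset.sum_comm]
          exact sum_congr rfl fun d _ => sum_move_third.symm
        rw [hr]
        refine sum_congr rfl fun d _ => ?_
        exact (sum_raise_mul ginv (fun p q => W p q d a) _).symm
    _ = (1 / 4) * g a c * ∑ p, ∑ q, ∑ r, ∑ s, V p q r s * V r s p q := by
        simp [key]
        ring
    _ = _ := by
        have hS : ∀ d e f k, ∑ p, ∑ q, ∑ r, ∑ s,
            ginv d p * ginv e q * ginv f r * ginv k s * W p q r s
              = ∑ p, ∑ q, ginv p d * ginv q e * V f k p q := by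
          intro d e f k
          simp only [V, Finset.mul_sum]
          refine sum_congr rfl fun p _ => sum_congr rfl fun q _ => sum_congr rfl fun r _ =>
            sum_congr rfl fun s _ => ?_
          rw [hs d p, hs e q, hW3 p q]
          ring
        simp only [hS]
        rw [sum_pair_comm (f := fun p q r s => V p q r s * V r s p q),
          sum_pair_comm (f := fun d e f k =>
            W d e f k * ∑ p, ∑ q, ginv p d * ginv q e * V f k p q)]
        congr 1
        exact sum_congr rfl fun r _ => sum_congr rfl fun s _ =>
          sum_raise_mul ginv (fun p q => W p q r s) (V r s)

/-- Component form of the identity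
`*(*(W_{da}∧θ_b)∧W^{d}{}_c) = −θ^{d} W_{afde} W_b{}^{e}{}_c{}^{f} + (1/8) θ_b g_{ac} W_{defh} W^{defh}`. -/
theorem double_dual_weyl_weyl_identity_one
    (g ginv : Fin 4 → Fin 4 → ℝ)
    (hg : ∀ a b, g a b = g b a)
    (hginv : ∀ a b, ∑ c, ginv a c * g c b = if a = b then (1 : ℝ) else 0)
    (hdet : (Matrix.of g).det < 0)
    (W : Fin 4 → Fin 4 → Fin 4 → Fin 4 → ℝ)
    (hW1 : ∀ a b c d, W a b c d = - W b a c d)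
    (hW2 : ∀ a b c d, W a b c d = - W a b d c)
    (hW3 : ∀ a b c d, W a b c d = W c d a b)
    (hW4 : ∀ a b c d, W a b c d + W a c d b + W a d b c = 0)
    (hWtr : ∀ b d, ∑ a, ∑ c, ginv a c * W a b c d = 0)
    (a b c h : Fin 4) :
    (1 / 4) * (∑ p, ∑ q, ∑ r, ∑ s, ∑ u, ∑ v, ∑ d,
        etaUp3 g ginv p q r s * etaUp3 g ginv s u v h *
          W p q d a * g r b * (∑ m, ginv d m * W u v m c))
      = -(∑ e, ∑ f, W a f h e * (∑ m, ∑ n, ginv e m * ginv f n * W b m c n))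
        + (1 / 8) * g h b * g a c *
          (∑ d, ∑ e, ∑ f, ∑ k,
            W d e f k *
              (∑ p, ∑ q, ∑ r, ∑ s,
                ginv d p * ginv e q * ginv f r * ginv k s * W p q r s)) := by
  have hs := symm_of_left_inverse hg hginv
  have step (r d : Fin 4) := sum_etaUp3_mul_etaUp3 g ginv (fun p q => W p q d a)
    (fun u v => ∑ m, ginv d m * W u v m c) hg hginv hdet (fun p q => hW1 p q d a)
    (fun u v => by simp only [hW1 u v, mul_neg, Finset.sum_neg_distrib]) r h
  have hL : (∑ p, ∑ q, ∑ r, ∑ s, ∑ u, ∑ v, ∑ d,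
        etaUp3 g ginv p q r s * etaUp3 g ginv s u v h *
          W p q d a * g r b * (∑ m, ginv d m * W u v m c))
      = ∑ d, ∑ r, g r b * ∑ s, (∑ p, ∑ q, etaUp3 g ginv p q r s * W p q d a) *
          (∑ u, ∑ v, etaUp3 g ginv s u v h * ∑ m, ginv d m * W u v m c) := by
    exact sum_seven_reorder (etaUp3 g ginv) (etaUp3 g ginv) (fun p q d => W p q d a)
      (fun d u v => ∑ m, ginv d m * W u v m c) (fun r => g r b) h
  have h2 : ∑ d, ∑ r, g r b * ∑ x, W h x d a *
        (∑ u, ∑ v, ginv u x * ginv v r * ∑ m, ginv d m * W u v m c)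
      = -(∑ e, ∑ f, W a f h e * (∑ m, ∑ n, ginv e m * ginv f n * W b m c n)) := by
    have hr (d x : Fin 4) : ∑ r, g r b *
        (∑ u, ∑ v, ginv u x * ginv v r * ∑ m, ginv d m * W u v m c)
        = ∑ u, ∑ m, ginv x u * ginv d m * W u b m c := by
      have (u v : Fin 4) : (∑ r, ginv v r * g r b) * (ginv u x * ∑ m, ginv d m * W u v m c)
          = if v = b then ∑ m, ginv x u * ginv d m * W u b m c else 0 := by
        rw [hginv]
        split_ifs with hv
        · subst hv
          rw [one_mul, Finset.mul_sum]
          exact sum_congr rfl fun m _ => by rw [hs u x]; ring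
        · simp
      calc _ = ∑ u, ∑ v, (∑ r, ginv v r * g r b) *
            (ginv u x * ∑ m, ginv d m * W u v m c) := by
            simp only [Finset.sum_mul, Finset.mul_sum]
            rw [← sum_move_third]
            refine sum_congr rfl fun u _ => sum_congr rfl fun v _ => ?_
            rw [Finset.sum_comm]
            exact sum_congr rfl fun m _ => sum_congr rfl fun r _ => by ring
        _ = _ := by simp [this]
    have hx (d : Fin 4) : ∑ r, g r b * ∑ x, W h x d a *
        (∑ u, ∑ v, ginv u x * ginv v r * ∑ m, ginv d m * W u v m c)
        = ∑ x, W h x d a * ∑ u, ∑ m, ginv x u * ginv d m * W u b m c := by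
      have swap (k w : Fin 4 → ℝ) (Z : Fin 4 → Fin 4 → ℝ) :
          ∑ r, k r * ∑ x, w x * Z x r = ∑ x, w x * ∑ r, k r * Z x r := by
        simp only [Finset.mul_sum]
        rw [Finset.sum_comm]
        exact sum_congr rfl fun x _ => sum_congr rfl fun r _ => by ring
      simp only [← hr]
      exact swap _ _ _
    simp only [hx]
    rw [Finset.sum_comm, ← Finset.sum_neg_distrib]
    refine sum_congr rfl fun e _ => ?_
    rw [← Finset.sum_neg_distrib]
    refine sum_congr rfl fun f _ => ?_
    rw [hW3 h e, hW1 f a, neg_mul, Finset.mul_sum, Finset.mul_sum]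
    congr 1
    refine sum_congr rfl fun m _ => ?_
    rw [Finset.mul_sum, Finset.mul_sum]
    refine sum_congr rfl fun n _ => ?_
    rw [hW1 m b, hW2 b m n c]
    ring
  have h1 : ∑ d, ∑ r, g r b * (if r = h then ∑ p, ∑ q, W p q d a *
        (∑ u, ∑ v, ginv u p * ginv v q * ∑ m, ginv d m * W u v m c) else 0)
      = (1 / 4) * g h b * g a c * (∑ d, ∑ e, ∑ f, ∑ k, W d e f k *
          (∑ p, ∑ q, ∑ r, ∑ s,
            ginv d p * ginv e q * ginv f r * ginv k s * W p q r s)) := by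
    simp only [mul_ite, mul_zero, Finset.sum_ite_eq', mem_univ, if_true]
    rw [← Finset.mul_sum, weyl_contraction g ginv hg hginv W hW1 hW2 hW3 hWtr a c]
    ring
  rw [hL]
  simp only [step]
  have split (α β : Fin 4 → Fin 4 → ℝ) : ∑ d, ∑ r, g r b * (2 * α d r + 4 * β d r)
      = 2 * ∑ d, ∑ r, g r b * α d r + 4 * ∑ d, ∑ r, g r b * β d r := by
    simp only [Finset.mul_sum, ← Finset.sum_add_distrib]
    exact sum_congr rfl fun d _ => sum_congr rfl fun r _ => by ring
  rw [split, h1, h2]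
  ring
end

section
/- Let g be a symmetric invertible 4×4 real matrix and let W have Weyl symmetries with respect to g. Then the Bel-Robinson tensor T of W is totally symmetric: for every permutation σ of the four index slots and all a,b,c,d in Fin 4, T_{abcd} = T_{σ(a)σ(b)σ(c)σ(d)} (i.e. T is invariant under every rearrangement of its four indices). -/
open Finset

/-- The Bel-Robinson tensor of `W`:
`T_{ablm} = W_{ajmk} W_b{}^{j}{}_l{}^{k} + W_{ajlk} W_b{}^{j}{}_m{}^{k}
  − (1/8) g_{ab} g_{lm} W_{dfgh} W^{dfgh}`. -/
noncomputable def belRobinson (g ginv : Fin 4 → Fin 4 → ℝ)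
    (W : Fin 4 → Fin 4 → Fin 4 → Fin 4 → ℝ) (a b l m : Fin 4) : ℝ :=
  (∑ j, ∑ k, W a j m k * (∑ p, ∑ q, ginv j p * ginv k q * W b p l q))
    + (∑ j, ∑ k, W a j l k * (∑ p, ∑ q, ginv j p * ginv k q * W b p m q))
    - (1 / 8) * g a b * g l m *
      (∑ d, ∑ f, ∑ e, ∑ h,
        W d f e h *
          (∑ p, ∑ q, ∑ r, ∑ s, ginv d p * ginv f q * ginv e r * ginv h s * W p q r s))

/-- An array on `Fin 4` that is antisymmetric in its three indices vanishes as soon as it vanishes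
on increasing triples. -/
lemma eq_zero_of_antisymm_of_increasing (F : Fin 4 → Fin 4 → Fin 4 → ℝ)
    (h12 : ∀ a b c, F a b c = -F b a c) (h23 : ∀ a b c, F a b c = -F a c b)
    (h : ∀ a b c, a < b → b < c → F a b c = 0) (a b c : Fin 4) : F a b c = 0 := by
  have e12 : ∀ a c, F a a c = 0 := fun a c => by linarith [h12 a a c]
  have e23 : ∀ a c, F a c c = 0 := fun a c => by linarith [h23 a c c]
  have h' : ∀ a b c, a < b → F a b c = 0 := by
    intro a b c hab
    rcases lt_trichotomy b c with hbc | rfl | hbc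
    · exact h a b c hab hbc
    · exact e23 a b
    · rw [h23, neg_eq_zero]
      rcases lt_trichotomy a c with hac | rfl | hac
      · exact h a c b hac hbc
      · exact e12 a b
      · rw [h12, neg_eq_zero]
        exact h c a b hac hab
  rcases lt_trichotomy a b with hab | rfl | hab
  · exact h' a b c hab
  · exact e12 a c
  · rw [h12, neg_eq_zero]
    exact h' b a c hab

/-- The antisymmetrization `9 U_{[ab}{}^{[cd} δ_{e]}{}^{f]}`. -/
def antisymmDelta (U : Fin 4 → Fin 4 → Fin 4 → Fin 4 → ℝ) (a b e c d f : Fin 4) : ℝ :=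
  (U a b c d * (if e = f then 1 else 0) + U b e c d * (if a = f then 1 else 0)
    + U e a c d * (if b = f then 1 else 0))
  + (U a b d f * (if e = c then 1 else 0) + U b e d f * (if a = c then 1 else 0)
    + U e a d f * (if b = c then 1 else 0))
  + (U a b f c * (if e = d then 1 else 0) + U b e f c * (if a = d then 1 else 0)
    + U e a f c * (if b = d then 1 else 0))

section TraceFree

variable {U : Fin 4 → Fin 4 → Fin 4 → Fin 4 → ℝ}
  (hl : ∀ a b c d, U a b c d = -U b a c d) (hu : ∀ a b c d, U a b c d = -U a b d c)
  (htr : ∀ b d, ∑ a, U a b a d = 0)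

include hl hu htr

/-- In dimension four, `U_{[ab}{}^{[cd} δ_{e]}{}^{f]} = 0` for every trace-free double two-form. -/
lemma antisymmDelta_eq_zero (a b e c d f : Fin 4) : antisymmDelta U a b e c d f = 0 := by
  refine eq_zero_of_antisymm_of_increasing (fun a b e => antisymmDelta U a b e c d f)
    ?_ ?_ ?_ a b e
  · intro a b e
    simp only [antisymmDelta]
    rw [hl a b c d, hl b e c d, hl e a c d, hl a b d f, hl b e d f, hl e a d f, hl a b f c,
      hl b e f c, hl e a f c]
    ring
  · intro a b e
    simp only [antisymmDelta]
    rw [hl a b c d, hl b e c d, hl e a c d, hl a b d f, hl b e d f, hl e a d f, hl a b f c,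
      hl b e f c, hl e a f c]
    ring
  intro a b e hab hbe
  refine eq_zero_of_antisymm_of_increasing (fun c d f => antisymmDelta U a b e c d f)
    ?_ ?_ ?_ c d f
  · intro c d f
    simp only [antisymmDelta]
    rw [hu a b c d, hu b e c d, hu e a c d, hu a b d f, hu b e d f, hu e a d f, hu a b f c,
      hu b e f c, hu e a f c]
    ring
  · intro c d f
    simp only [antisymmDelta]
    rw [hu a b c d, hu b e c d, hu e a c d, hu a b d f, hu b e d f, hu e a d f, hu a b f c,
      hu b e f c, hu e a f c]
    ring
  intro c d f hcd hdf
  have dl : ∀ a c d, U a a c d = 0 := fun a c d => by linarith [hl a a c d]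
  have du : ∀ a b c, U a b c c = 0 := fun a b c => by linarith [hu a b c c]
  simp only [Fin.sum_univ_four] at htr
  have t00 := htr 0 0
  have t01 := htr 0 1
  have t02 := htr 0 2
  have t03 := htr 0 3
  have t10 := htr 1 0
  have t11 := htr 1 1
  have t12 := htr 1 2
  have t13 := htr 1 3
  have t20 := htr 2 0
  have t21 := htr 2 1
  have t22 := htr 2 2
  have t23 := htr 2 3
  have t30 := htr 3 0
  have t31 := htr 3 1
  have t32 := htr 3 2
  have t33 := htr 3 3
  clear htr
  simp only [dl, du, hl 1 0, hl 2 0, hl 3 0, hl 2 1, hl 3 1, hl 3 2, hu _ _ 1 0, hu _ _ 2 0,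
    hu _ _ 3 0, hu _ _ 2 1, hu _ _ 3 1, hu _ _ 3 2] at *
  have key : ∀ x y z : Fin 4, x < y → y < z → (x = 0 ∧ y = 1 ∧ z = 2) ∨ (x = 0 ∧ y = 1 ∧ z = 3)
      ∨ (x = 0 ∧ y = 2 ∧ z = 3) ∨ (x = 1 ∧ y = 2 ∧ z = 3) := by decide
  rcases key a b e hab hbe with
    ⟨rfl, rfl, rfl⟩ | ⟨rfl, rfl, rfl⟩ | ⟨rfl, rfl, rfl⟩ | ⟨rfl, rfl, rfl⟩ <;>
  rcases key c d f hcd hdf with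
    ⟨rfl, rfl, rfl⟩ | ⟨rfl, rfl, rfl⟩ | ⟨rfl, rfl, rfl⟩ | ⟨rfl, rfl, rfl⟩ <;>
  simp [antisymmDelta, hl 2 0, hl 3 0, hl 3 1, hu _ _ 2 0, hu _ _ 3 0, hu _ _ 3 1] <;> linarith


lemma sum_mul_antisymmDelta (b e f m : Fin 4) :
    (if e = f then 1 else 0) * (∑ a, ∑ c, ∑ d, U a b c d * U c d a m)
      - (if b = f then 1 else 0) * (∑ a, ∑ c, ∑ d, U a e c d * U c d a m)
      + (∑ c, ∑ d, U b e c d * U c d f m)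
      + 2 * (∑ a, ∑ d, U a b d f * U e d a m) - 2 * (∑ a, ∑ d, U a e d f * U b d a m) = 0 := by
  have h : ∑ a, ∑ c, ∑ d, antisymmDelta U a b e c d f * U c d a m = 0 := by
    simp only [antisymmDelta_eq_zero hl hu htr, zero_mul, sum_const_zero]
  have h1 : ∑ a, ∑ c, ∑ d, U a b c d * (if e = f then 1 else 0) * U c d a m
      = (if e = f then 1 else 0) * (∑ a, ∑ c, ∑ d, U a b c d * U c d a m) := by
    split_ifs <;> simp
  have h2 : ∑ a, ∑ c, ∑ d, U b e c d * (if a = f then 1 else 0) * U c d a m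
      = ∑ c, ∑ d, U b e c d * U c d f m := by
    simp [mul_ite, ite_mul, sum_ite_irrel]
  have h3 : ∑ a, ∑ c, ∑ d, U e a c d * (if b = f then 1 else 0) * U c d a m
      = - ((if b = f then 1 else 0) * (∑ a, ∑ c, ∑ d, U a e c d * U c d a m)) := by
    simp only [hl e]
    split_ifs <;> simp
  have h4 : ∑ a, ∑ c, ∑ d, U a b d f * (if e = c then 1 else 0) * U c d a m
      = ∑ a, ∑ d, U a b d f * U e d a m := by
    simp [mul_ite, ite_mul, sum_ite_irrel]
  have h5 : ∑ a, ∑ c, ∑ d, U b e d f * (if a = c then 1 else 0) * U c d a m = 0 := by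
    simp only [mul_ite, ite_mul, mul_one, mul_zero, zero_mul, sum_ite_irrel, sum_const_zero,
      sum_ite_eq, mem_univ, if_true]
    rw [sum_comm]
    simp only [← mul_sum, htr, mul_zero, sum_const_zero]
  have h6 : ∑ a, ∑ c, ∑ d, U e a d f * (if b = c then 1 else 0) * U c d a m
      = - ∑ a, ∑ d, U a e d f * U b d a m := by
    simp only [hl e]
    simp [mul_ite, ite_mul, sum_ite_irrel]
  have h7 : ∑ a, ∑ c, ∑ d, U a b f c * (if e = d then 1 else 0) * U c d a m
      = ∑ a, ∑ d, U a b d f * U e d a m := by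
    simp only [mul_ite, ite_mul, mul_one, mul_zero, zero_mul, sum_ite_eq, mem_univ, if_true]
    refine sum_congr rfl fun a _ => sum_congr rfl fun d _ => ?_
    rw [hu a b f d, hl d e]
    ring
  have h8 : ∑ a, ∑ c, ∑ d, U b e f c * (if a = d then 1 else 0) * U c d a m = 0 := by
    simp only [mul_ite, ite_mul, mul_one, mul_zero, zero_mul, sum_ite_eq, mem_univ, if_true]
    rw [sum_comm]
    refine sum_eq_zero fun c _ => ?_
    simp only [hl c, mul_neg, sum_neg_distrib, ← mul_sum, htr, mul_zero, neg_zero]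
  have h9 : ∑ a, ∑ c, ∑ d, U e a f c * (if b = d then 1 else 0) * U c d a m
      = - ∑ a, ∑ d, U a e d f * U b d a m := by
    simp only [mul_ite, ite_mul, mul_one, mul_zero, zero_mul, sum_ite_eq, mem_univ, if_true]
    simp only [← sum_neg_distrib]
    refine sum_congr rfl fun a _ => sum_congr rfl fun d _ => ?_
    rw [hl e a f d, hu a e f d, hl d b]
    ring
  simp only [antisymmDelta, add_mul, sum_add_distrib] at h
  rw [h1, h2, h3, h4, h5, h6, h7, h8, h9] at h
  linarith

/-- In dimension four, `4 U_{ae}{}^{cd} U_{cd}{}^{af} = δ_e{}^f U_{ab}{}^{cd} U_{cd}{}^{ab}`. -/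
lemma four_mul_sum_mul (e f : Fin 4) :
    4 * (∑ a, ∑ c, ∑ d, U a e c d * U c d a f)
      = (if e = f then 1 else 0) * (∑ b, ∑ a, ∑ c, ∑ d, U a b c d * U c d a b) := by
  have h : ∑ b, ((if e = f then 1 else 0) * (∑ a, ∑ c, ∑ d, U a b c d * U c d a b)
      - (if b = f then 1 else 0) * (∑ a, ∑ c, ∑ d, U a e c d * U c d a b)
      + (∑ c, ∑ d, U b e c d * U c d f b)
      + 2 * (∑ a, ∑ d, U a b d f * U e d a b) - 2 * (∑ a, ∑ d, U a e d f * U b d a b)) = 0 :=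
    sum_eq_zero fun b _ => sum_mul_antisymmDelta hl hu htr b e f b
  have h2 : ∑ b, (if b = f then 1 else 0) * (∑ a, ∑ c, ∑ d, U a e c d * U c d a b)
      = ∑ a, ∑ c, ∑ d, U a e c d * U c d a f := by
    simp only [ite_mul, one_mul, zero_mul, sum_ite_eq', mem_univ, if_true]
  have h3 : ∑ b, ∑ c, ∑ d, U b e c d * U c d f b
      = - ∑ a, ∑ c, ∑ d, U a e c d * U c d a f := by
    simp only [hu _ _ f, mul_neg, sum_neg_distrib]
  have h4 : ∑ b, ∑ a, ∑ d, U a b d f * U e d a b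
      = - ∑ a, ∑ c, ∑ d, U a e c d * U c d a f := by
    rw [sum_comm]
    simp only [hl e, mul_neg, sum_neg_distrib]
    rw [sum_congr rfl fun a _ => sum_comm, sum_comm]
    simp only [mul_comm]
  have h5 : ∑ b, ∑ a, ∑ d, U a e d f * U b d a b = 0 := by
    rw [sum_comm]
    refine sum_eq_zero fun a _ => ?_
    rw [sum_comm]
    refine sum_eq_zero fun d _ => ?_
    simp only [hu _ _ a, mul_neg, sum_neg_distrib, ← mul_sum, htr, mul_zero, neg_zero]
  simp only [sum_sub_distrib, sum_add_distrib, ← mul_sum, h2, h3, h4, h5] at h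
  linarith

/-- The quadratic identity in dimension four satisfied by a trace-free double two-form. -/
lemma quadratic_identity (b e f m : Fin 4) :
    ((if e = f then 1 else 0) * (if b = m then 1 else 0)
        - (if b = f then 1 else 0) * (if e = m then 1 else 0))
        * ((∑ b, ∑ a, ∑ c, ∑ d, U a b c d * U c d a b) / 4)
      + (∑ c, ∑ d, U b e c d * U c d f m)
      + 2 * (∑ a, ∑ d, U a b d f * U e d a m) - 2 * (∑ a, ∑ d, U a e d f * U b d a m) = 0 := by
  have h := sum_mul_antisymmDelta hl hu htr b e f m
  have h1 := four_mul_sum_mul hl hu htr b m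
  have h2 := four_mul_sum_mul hl hu htr e m
  linear_combination h - (if e = f then 1 else 0) / 4 * h1 + (if b = f then 1 else 0) / 4 * h2

end TraceFree

lemma sum_comm_pair (F : Fin 4 → Fin 4 → Fin 4 → Fin 4 → ℝ) :
    ∑ p, ∑ q, ∑ r, ∑ s, F p q r s = ∑ r, ∑ s, ∑ p, ∑ q, F p q r s := by
  rw [sum_congr rfl fun p _ => sum_comm, sum_comm]
  refine sum_congr rfl fun r _ => ?_
  rw [sum_congr rfl fun p _ => sum_comm, sum_comm]

/-- The tensor `W_{abc}{}^d`. -/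
def raiseLast (ginv : Fin 4 → Fin 4 → ℝ) (W : Fin 4 → Fin 4 → Fin 4 → Fin 4 → ℝ)
    (a b c d : Fin 4) : ℝ :=
  ∑ k, ginv d k * W a b c k

/-- The tensor `W_{ab}{}^{cd}`. -/
def raisePair (ginv : Fin 4 → Fin 4 → ℝ) (W : Fin 4 → Fin 4 → Fin 4 → Fin 4 → ℝ)
    (a b c d : Fin 4) : ℝ :=
  ∑ p, ginv c p * raiseLast ginv W a b p d

/-- The tensor `W_{ajmk} W_b{}^j{}_l{}^k`. -/
def belProduct (ginv : Fin 4 → Fin 4 → ℝ) (W : Fin 4 → Fin 4 → Fin 4 → Fin 4 → ℝ)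
    (a m b l : Fin 4) : ℝ :=
  ∑ j, ∑ k, W a j m k * (∑ p, ∑ q, ginv j p * ginv k q * W b p l q)

/-- The scalar `W_{abcd} W^{abcd}`. -/
def weylSq (ginv : Fin 4 → Fin 4 → ℝ) (W : Fin 4 → Fin 4 → Fin 4 → Fin 4 → ℝ) : ℝ :=
  ∑ d, ∑ f, ∑ e, ∑ h, W d f e h *
    (∑ p, ∑ q, ∑ r, ∑ s, ginv d p * ginv f q * ginv e r * ginv h s * W p q r s)

lemma belRobinson_eq (g ginv : Fin 4 → Fin 4 → ℝ) (W : Fin 4 → Fin 4 → Fin 4 → Fin 4 → ℝ)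
    (a b l m : Fin 4) :
    belRobinson g ginv W a b l m = belProduct ginv W a m b l + belProduct ginv W a l b m
      - (1 / 8) * g a b * g l m * weylSq ginv W := rfl

lemma raisePair_eq (ginv : Fin 4 → Fin 4 → ℝ) (W : Fin 4 → Fin 4 → Fin 4 → Fin 4 → ℝ)
    (a b c d : Fin 4) :
    raisePair ginv W a b c d = ∑ p, ∑ q, ginv c p * ginv d q * W a b p q := by
  simp only [raisePair, raiseLast, mul_sum, mul_assoc]

section Metric

variable {g ginv : Fin 4 → Fin 4 → ℝ}

lemma sum_mul_inv (hginv : ∀ a b, ∑ c, ginv a c * g c b = if a = b then (1 : ℝ) else 0)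
    (a b : Fin 4) : ∑ c, g a c * ginv c b = if a = b then (1 : ℝ) else 0 := by
  have h : Matrix.of ginv * Matrix.of g = 1 := by
    ext a b
    simpa [Matrix.mul_apply, Matrix.one_apply] using hginv a b
  have h' : Matrix.of g * Matrix.of ginv = 1 := mul_eq_one_comm.mp h
  simpa [Matrix.mul_apply, Matrix.one_apply] using congrFun (congrFun h' a) b

lemma inv_symm (hg : ∀ a b, g a b = g b a)
    (hginv : ∀ a b, ∑ c, ginv a c * g c b = if a = b then (1 : ℝ) else 0)
    (a b : Fin 4) : ginv a b = ginv b a := by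
  have h : Matrix.of ginv * Matrix.of g = 1 := by
    ext a b
    simpa [Matrix.mul_apply, Matrix.one_apply] using hginv a b
  have h' : Matrix.of g * (Matrix.of ginv).transpose = 1 := by
    have ht : (Matrix.of g).transpose = Matrix.of g := by
      ext a b
      exact hg b a
    rw [← ht, ← Matrix.transpose_mul, h, Matrix.transpose_one]
  have h'' : Matrix.of ginv = (Matrix.of ginv).transpose := left_inv_eq_right_inv h h'
  exact congrFun (congrFun h'' a) b

lemma sum_mul_sum_inv_mul (hginv : ∀ a b, ∑ c, ginv a c * g c b = if a = b then (1 : ℝ) else 0)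
    (v : Fin 4 → ℝ) (x : Fin 4) : ∑ c, g x c * ∑ p, ginv c p * v p = v x := by
  simp only [mul_sum, ← mul_assoc]
  rw [sum_comm]
  simp only [← sum_mul, sum_mul_inv hginv, ite_mul, one_mul, zero_mul, sum_ite_eq, mem_univ,
    if_true]

variable {W : Fin 4 → Fin 4 → Fin 4 → Fin 4 → ℝ}

lemma sum_mul_raiseLast (hginv : ∀ a b, ∑ c, ginv a c * g c b = if a = b then (1 : ℝ) else 0)
    (a b c x : Fin 4) : ∑ d, g x d * raiseLast ginv W a b c d = W a b c x :=
  sum_mul_sum_inv_mul hginv (W a b c) x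

lemma sum_mul_raisePair (hginv : ∀ a b, ∑ c, ginv a c * g c b = if a = b then (1 : ℝ) else 0)
    (a b d x : Fin 4) : ∑ c, g x c * raisePair ginv W a b c d = raiseLast ginv W a b x d :=
  sum_mul_sum_inv_mul hginv (fun p => raiseLast ginv W a b p d) x

lemma raiseLast_antisymm (hW1 : ∀ a b c d, W a b c d = -W b a c d) (a b c d : Fin 4) :
    raiseLast ginv W a b c d = -raiseLast ginv W b a c d := by
  simp only [raiseLast, ← sum_neg_distrib, ← mul_neg, ← hW1]

lemma raisePair_antisymm_left (hW1 : ∀ a b c d, W a b c d = -W b a c d) (a b c d : Fin 4) :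
    raisePair ginv W a b c d = -raisePair ginv W b a c d := by
  simp only [raisePair, ← sum_neg_distrib, ← mul_neg, ← raiseLast_antisymm hW1]

lemma raisePair_antisymm_right (hW2 : ∀ a b c d, W a b c d = -W a b d c) (a b c d : Fin 4) :
    raisePair ginv W a b c d = -raisePair ginv W a b d c := by
  rw [raisePair_eq, raisePair_eq, sum_comm, ← sum_neg_distrib]
  refine sum_congr rfl fun q _ => ?_
  rw [← sum_neg_distrib]
  refine sum_congr rfl fun p _ => ?_
  rw [hW2 a b p q]
  ring

lemma sum_raisePair_eq_zero (hWtr : ∀ b d, ∑ a, ∑ c, ginv a c * W a b c d = 0) (b d : Fin 4) :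
    ∑ a, raisePair ginv W a b a d = 0 := by
  have h : ∑ a, raisePair ginv W a b a d
      = ∑ q, ginv d q * ∑ a, ∑ p, ginv a p * W a b p q := by
    simp only [raisePair_eq, mul_sum]
    rw [sum_congr rfl fun a _ => sum_comm, sum_comm]
    refine sum_congr rfl fun q _ => sum_congr rfl fun a _ => sum_congr rfl fun p _ => ?_
    ring
  simp only [h, hWtr, mul_zero, sum_const_zero]

lemma sum_raisePair_mul_raisePair (hs : ∀ a b, ginv a b = ginv b a)
    (hW3 : ∀ a b c d, W a b c d = W c d a b) :
    ∑ b, ∑ a, ∑ c, ∑ d, raisePair ginv W a b c d * raisePair ginv W c d a b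
      = weylSq ginv W := by
  have h : ∀ d f e h, ∑ p, ∑ q, ∑ r, ∑ s,
      ginv d p * ginv f q * ginv e r * ginv h s * W p q r s
      = ∑ r, ∑ s, ginv e r * ginv h s * raisePair ginv W r s d f := by
    intro d f e h
    simp only [raisePair_eq, mul_sum]
    rw [sum_comm_pair]
    refine sum_congr rfl fun r _ => sum_congr rfl fun s _ => sum_congr rfl fun p _ =>
      sum_congr rfl fun q _ => ?_
    rw [hW3 p q r s]
    ring
  simp only [weylSq, h]
  rw [sum_comm]
  refine sum_congr rfl fun a _ => sum_congr rfl fun b _ => ?_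
  simp only [raisePair_eq ginv W a b, sum_mul, mul_sum]
  rw [sum_comm_pair]
  refine sum_congr rfl fun r _ => sum_congr rfl fun s _ => sum_congr rfl fun c _ =>
    sum_congr rfl fun d _ => ?_
  rw [hs c r, hs d s]
  ring

lemma belProduct_eq (hs : ∀ a b, ginv a b = ginv b a) (hW3 : ∀ a b c d, W a b c d = W c d a b)
    (a m b l : Fin 4) :
    belProduct ginv W a m b l
      = ∑ j, ∑ q, raiseLast ginv W a j m q * raiseLast ginv W l q b j := by
  simp only [belProduct, raiseLast, sum_mul_sum]
  refine sum_congr rfl fun j _ => ?_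
  simp only [mul_sum]
  rw [sum_congr rfl fun k _ => sum_comm, sum_comm]
  refine sum_congr rfl fun q _ => sum_congr rfl fun k _ => sum_congr rfl fun p _ => ?_
  rw [hs k q, hW3 b p l q]
  ring

lemma belProduct_reverse (hs : ∀ a b, ginv a b = ginv b a)
    (hW3 : ∀ a b c d, W a b c d = W c d a b) (a m b l : Fin 4) :
    belProduct ginv W a m b l = belProduct ginv W l b m a := by
  rw [belProduct_eq hs hW3, belProduct_eq hs hW3, sum_comm]
  simp only [mul_comm]

lemma belProduct_swap (hW3 : ∀ a b c d, W a b c d = W c d a b) (a m b l : Fin 4) :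
    belProduct ginv W a m b l = belProduct ginv W m a l b := by
  rw [belProduct, belProduct, sum_comm]
  refine sum_congr rfl fun k _ => sum_congr rfl fun j _ => ?_
  rw [hW3 a j m k, sum_comm]
  refine congrArg _ (sum_congr rfl fun q _ => sum_congr rfl fun p _ => ?_)
  rw [hW3 b p l q]
  ring

lemma sum_raisePair_mul (hW2 : ∀ a b c d, W a b c d = -W a b d c)
    (hW3 : ∀ a b c d, W a b c d = W c d a b)
    (hW4 : ∀ a b c d, W a b c d + W a c d b + W a d b c = 0) (b e x y : Fin 4) :
    ∑ c, ∑ d, raisePair ginv W b e c d * W c d x y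
      = 2 * (belProduct ginv W x y b e - belProduct ginv W x y e b) := by
  have hB : ∀ a b c d, W a b c d = W a c b d - W b c a d := fun a b c d => by
    linarith [hW4 a b c d, hW2 a c d b, hW3 a d b c]
  have h : ∑ c, ∑ d, raisePair ginv W b e c d * W c d x y
      = belProduct ginv W x y b e - belProduct ginv W x y e b
        - (belProduct ginv W y x b e - belProduct ginv W y x e b) := by
    simp only [belProduct, ← sum_sub_distrib]
    refine sum_congr rfl fun c _ => sum_congr rfl fun d _ => ?_
    have hU : raisePair ginv W b e c d = (∑ p, ∑ q, ginv c p * ginv d q * W b p e q)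
        - ∑ p, ∑ q, ginv c p * ginv d q * W e p b q := by
      simp only [raisePair_eq, ← sum_sub_distrib, ← mul_sub, ← hB]
    rw [hU, hW3 c d x y, hB x y c d]
    ring
  rw [h, belProduct_swap hW3 y x, belProduct_swap hW3 y x]
  ring

/-- The quadratic identity for `W_{ab}{}^{cd}` with all indices lowered. -/
lemma belProduct_identity (hg : ∀ a b, g a b = g b a)
    (hginv : ∀ a b, ∑ c, ginv a c * g c b = if a = b then (1 : ℝ) else 0)
    (hW1 : ∀ a b c d, W a b c d = -W b a c d) (hW2 : ∀ a b c d, W a b c d = -W a b d c)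
    (hW3 : ∀ a b c d, W a b c d = W c d a b)
    (hW4 : ∀ a b c d, W a b c d + W a c d b + W a d b c = 0)
    (hWtr : ∀ b d, ∑ a, ∑ c, ginv a c * W a b c d = 0) (b e x y : Fin 4) :
    (g x e * g y b - g x b * g y e) * (weylSq ginv W / 4)
      + 2 * (belProduct ginv W x y b e - belProduct ginv W x y e b)
      - 2 * belProduct ginv W b x y e + 2 * belProduct ginv W e x y b = 0 := by
  have hs := inv_symm hg hginv
  have hl := raisePair_antisymm_left (ginv := ginv) hW1
  have hu := raisePair_antisymm_right (ginv := ginv) hW2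
  have h : ∑ f, ∑ m, g x f * g y m * _ = 0 := sum_eq_zero fun f _ => sum_eq_zero fun m _ =>
    mul_eq_zero_of_right _
      (quadratic_identity hl hu (sum_raisePair_eq_zero hWtr) b e f m)
  have h1 : ∑ f, ∑ m, g x f * g y m * (((if e = f then 1 else 0) * (if b = m then 1 else 0)
      - (if b = f then 1 else 0) * (if e = m then 1 else 0)) * (weylSq ginv W / 4))
      = (g x e * g y b - g x b * g y e) * (weylSq ginv W / 4) := by
    simp only [← mul_assoc, ← sum_mul, mul_sub, sum_sub_distrib, mul_ite, mul_one, mul_zero,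
      sum_ite_eq, mem_univ, if_true]
  have h2 : ∑ f, ∑ m, g x f * g y m *
      (∑ c, ∑ d, raisePair ginv W b e c d * raisePair ginv W c d f m)
      = 2 * (belProduct ginv W x y b e - belProduct ginv W x y e b) := by
    have hW : ∀ c d, ∑ f, ∑ m, g x f * g y m * raisePair ginv W c d f m = W c d x y := by
      intro c d
      simp only [← sum_mul_raiseLast hginv c d x y, ← sum_mul_raisePair hginv c d, mul_sum]
      rw [sum_comm]
      refine sum_congr rfl fun m _ => sum_congr rfl fun f _ => ?_
      ring
    rw [← sum_raisePair_mul hW2 hW3 hW4]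
    simp only [← hW, mul_sum]
    rw [sum_comm_pair]
    refine sum_congr rfl fun c _ => sum_congr rfl fun d _ => sum_congr rfl fun f _ =>
      sum_congr rfl fun m _ => ?_
    ring
  have h3 : ∀ b e, ∑ f, ∑ m, g x f * g y m *
      (∑ a, ∑ d, raisePair ginv W a b d f * raisePair ginv W e d a m)
      = - belProduct ginv W b x y e := by
    intro b e
    have hW : ∀ a b c z, ∑ f, g z f * raisePair ginv W a b c f = - raiseLast ginv W a b z c := by
      intro a b c z
      simp only [hu a b c, mul_neg, sum_neg_distrib, sum_mul_raisePair hginv]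
    rw [belProduct_eq hs hW3, ← sum_neg_distrib]
    simp only [← sum_neg_distrib, ← neg_mul, ← raiseLast_antisymm hW1]
    have hA : ∀ a d, raiseLast ginv W a b x d * raiseLast ginv W e d y a
        = ∑ f, ∑ m, (g x f * raisePair ginv W a b d f) * (g y m * raisePair ginv W e d a m) := by
      intro a d
      rw [← sum_mul_sum, hW, hW, neg_mul_neg]
    simp only [hA, mul_sum]
    rw [sum_comm_pair]
    refine sum_congr rfl fun c _ => sum_congr rfl fun d _ => sum_congr rfl fun f _ =>
      sum_congr rfl fun m _ => ?_
    ring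
  have h4 : ∀ b e, ∑ f, ∑ m, 2 * (g x f * g y m *
      (∑ a, ∑ d, raisePair ginv W a b d f * raisePair ginv W e d a m))
      = 2 * -belProduct ginv W b x y e := by
    intro b e
    rw [← h3]
    simp only [mul_sum]
  simp only [sum_raisePair_mul_raisePair hs hW3, mul_add, mul_sub, sum_add_distrib,
    sum_sub_distrib, mul_left_comm _ (2 : ℝ)] at h
  rw [h1, h2, h4, h4] at h
  linarith

end Metric

/-- A function of four variables invariant under adjacent transpositions of its arguments is
invariant under all permutations. -/
lemma eq_apply_perm {α β : Type*} (T : α → α → α → α → β)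
    (h01 : ∀ a b c d, T a b c d = T b a c d) (h12 : ∀ a b c d, T a b c d = T a c b d)
    (h23 : ∀ a b c d, T a b c d = T a b d c) (σ : Equiv.Perm (Fin 4)) (v : Fin 4 → α) :
    T (v 0) (v 1) (v 2) (v 3) = T (v (σ 0)) (v (σ 1)) (v (σ 2)) (v (σ 3)) := by
  have hσ : σ ∈ Submonoid.closure
      (Set.range fun i : Fin 3 => Equiv.swap i.castSucc i.succ) := by
    rw [Equiv.Perm.mclosure_swap_castSucc_succ]
    trivial
  induction hσ using Submonoid.closure_induction generalizing v with
  | mem τ hτ =>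
    obtain ⟨i, rfl⟩ := hτ
    fin_cases i
    · exact h01 _ _ _ _
    · exact h12 _ _ _ _
    · exact h23 _ _ _ _
  | one => rfl
  | mul τ ρ _ _ hτ hρ => exact (hτ v).trans (hρ (v ∘ τ))

/-- The Bel-Robinson tensor is totally symmetric: it is invariant under every
rearrangement of its four indices. -/
theorem belRobinson_totally_symmetric
    (g ginv : Fin 4 → Fin 4 → ℝ)
    (hg : ∀ a b, g a b = g b a)
    (hginv : ∀ a b, ∑ c, ginv a c * g c b = if a = b then (1 : ℝ) else 0)
    (W : Fin 4 → Fin 4 → Fin 4 → Fin 4 → ℝ)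
    (hW1 : ∀ a b c d, W a b c d = - W b a c d)
    (hW2 : ∀ a b c d, W a b c d = - W a b d c)
    (hW3 : ∀ a b c d, W a b c d = W c d a b)
    (hW4 : ∀ a b c d, W a b c d + W a c d b + W a d b c = 0)
    (hWtr : ∀ b d, ∑ a, ∑ c, ginv a c * W a b c d = 0)
    (σ : Equiv.Perm (Fin 4)) (a b c d : Fin 4) :
    belRobinson g ginv W a b c d
      = belRobinson g ginv W (![a, b, c, d] (σ 0)) (![a, b, c, d] (σ 1))
          (![a, b, c, d] (σ 2)) (![a, b, c, d] (σ 3)) := by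
  have hs := inv_symm hg hginv
  have hrev := belProduct_reverse hs hW3
  have hswap := belProduct_swap (ginv := ginv) hW3
  refine eq_apply_perm (belRobinson g ginv W) ?_ ?_ ?_ σ ![a, b, c, d]
  · intro a b l m
    rw [belRobinson_eq, belRobinson_eq, hg a b, hrev a m, hswap l b, hrev a l, hswap m b]
    ring
  · intro f b e m
    have h := belProduct_identity hg hginv hW1 hW2 hW3 hW4 hWtr b e f m
    rw [hswap b f, hswap e f, hg m b, hg m e] at h
    rw [belRobinson_eq, belRobinson_eq]
    linarith
  · intro a b l m
    rw [belRobinson_eq, belRobinson_eq, hg l m]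
    ring
end

section
/- Let g = diag(−1,1,1,1) be the Minkowski metric on Fin 4 → ℝ and let W have Weyl symmetries with respect to g, with Bel-Robinson tensor T. If u₁, u₂, u₃, u₄ : Fin 4 → ℝ are timelike future-directed vectors (⟨uᵢ,uᵢ⟩ < 0 and uᵢ⁰ > 0 for i = 1,…,4) and the superenergy density vanishes, Σ_{a,b,c,d} T_{abcd} u₁^a u₂^b u₃^c u₄^d = 0, then W = 0 (all components W_{abcd} vanish). -/
open Finset

/-- The Minkowski metric `diag(−1,1,1,1)` on `Fin 4 → ℝ` (which is its own inverse). -/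
noncomputable def mink : Fin 4 → Fin 4 → ℝ :=
  fun a b => if a = b then (if a = 0 then -1 else 1) else 0

/-- The Bel-Robinson tensor of `W` with respect to the Minkowski metric:
`T_{ablm} = W_{ajmk} W_b{}^{j}{}_l{}^{k} + W_{ajlk} W_b{}^{j}{}_m{}^{k}
  − (1/8) g_{ab} g_{lm} W_{dfgh} W^{dfgh}`. -/
noncomputable def belRobinsonMink
    (W : Fin 4 → Fin 4 → Fin 4 → Fin 4 → ℝ) (a b l m : Fin 4) : ℝ :=
  (∑ j, ∑ k, W a j m k * (∑ p, ∑ q, mink j p * mink k q * W b p l q))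
    + (∑ j, ∑ k, W a j l k * (∑ p, ∑ q, mink j p * mink k q * W b p m q))
    - (1 / 8) * mink a b * mink l m *
      (∑ d, ∑ f, ∑ e, ∑ h,
        W d f e h *
          (∑ p, ∑ q, ∑ r, ∑ s, mink d p * mink f q * mink e r * mink h s * W p q r s))

section BelRobinsonSpinor

open Complex Matrix ComplexConjugate ComplexOrder

/-- The Pauli matrices, with the identity as the timelike component. -/
def pauli : Fin 4 → Matrix (Fin 2) (Fin 2) ℂ :=
  ![!![1, 0; 0, 1], !![0, 1; 1, 0], !![0, -I; I, 0], !![1, 0; 0, -1]]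

/-- The full contraction of a `2 × 2` matrix with a two-index array. -/
def spinorPairing (M : Matrix (Fin 2) (Fin 2) ℂ) (f : Fin 2 → Fin 2 → ℂ) : ℂ :=
  ∑ A, ∑ A', M A A' * f A A'

/-- The Hermitian form `Ψ̄ ⊗ Ψ` of a four-index spinor contracted with four matrices. -/
def spinorEnergy (M₁ M₂ M₃ M₄ : Matrix (Fin 2) (Fin 2) ℂ)
    (Ψ : Fin 2 → Fin 2 → Fin 2 → Fin 2 → ℂ) : ℂ :=
  spinorPairing M₁ fun A A' => spinorPairing M₂ fun B B' => spinorPairing M₃ fun C C' =>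
    spinorPairing M₄ fun D D' => conj (Ψ A B C D) * Ψ A' B' C' D'

/-- The five Weyl scalars of an array with Weyl symmetries. -/
def weylScalar (W : Fin 4 → Fin 4 → Fin 4 → Fin 4 → ℝ) : ℕ → ℂ
  | 0 => ⟨W 0 1 0 1 - W 0 2 0 2 - 2 * W 0 1 1 3, W 0 1 2 3 + W 0 2 1 3 - 2 * W 0 1 0 2⟩
  | 1 => ⟨-W 0 1 0 3 - W 0 2 1 2, W 0 2 0 3 - W 0 1 1 2⟩
  | 2 => ⟨-W 0 1 0 1 - W 0 2 0 2, W 0 2 1 3 - W 0 1 2 3⟩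
  | 3 => ⟨W 0 1 0 3 - W 0 2 1 2, W 0 2 0 3 + W 0 1 1 2⟩
  | _ => ⟨W 0 1 0 1 - W 0 2 0 2 + 2 * W 0 1 1 3, W 0 1 2 3 + W 0 2 1 3 + 2 * W 0 1 0 2⟩

/-- The totally symmetric Weyl spinor. -/
def weylSpinor (W : Fin 4 → Fin 4 → Fin 4 → Fin 4 → ℝ) (A B C D : Fin 2) : ℂ :=
  weylScalar W (A + B + C + D)

lemma fin_four_cases (a : Fin 4) : a = 0 ∨ a = 1 ∨ a = 2 ∨ a = 3 := by
  revert a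
  decide

lemma mink_comm (a b : Fin 4) : mink a b = mink b a := by
  by_cases h : a = b
  · rw [h]
  · simp [mink, h, Ne.symm h]

lemma mink_of_ne {a b : Fin 4} (h : a ≠ b) : mink a b = 0 := by
  simp [mink, h]

lemma mink_zero : mink 0 0 = -1 := by
  simp [mink]

lemma mink_self {a : Fin 4} (h : a ≠ 0) : mink a a = 1 := by
  simp [mink, h]

lemma sum_mink_mul (j : Fin 4) (f : Fin 4 → ℝ) :
    ∑ p, mink j p * f p = mink j j * f j := by
  rw [Finset.sum_eq_single j]
  · intro p _ hp
    simp [mink, hp.symm]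
  · simp

lemma sum_mink_diag_mul (f : Fin 4 → ℝ) :
    ∑ j, mink j j * f j = -f 0 + f 1 + f 2 + f 3 := by
  simp [Fin.sum_univ_four, mink]

lemma belRobinsonMink_eq (W : Fin 4 → Fin 4 → Fin 4 → Fin 4 → ℝ) (a b l m : Fin 4) :
    belRobinsonMink W a b l m =
      (∑ j, ∑ k, mink j j * mink k k * (W a j m k * W b j l k + W a j l k * W b j m k))
      - (1 / 8) * mink a b * mink l m *
        ∑ d, ∑ f, ∑ e, ∑ h, mink d d * mink f f * mink e e * mink h h * W d f e h ^ 2 := by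
  simp only [belRobinsonMink, mul_assoc, ← Finset.mul_sum, sum_mink_mul, mul_add,
    Finset.sum_add_distrib]
  congr 1
  · congr 1 <;> refine Finset.sum_congr rfl fun j _ => ?_
    all_goals
      rw [Finset.mul_sum]
      refine Finset.sum_congr rfl fun k _ => ?_
      ring
  · congr 3
    refine Finset.sum_congr rfl fun d _ => ?_
    simp only [Finset.mul_sum]
    refine Finset.sum_congr rfl fun f _ => Finset.sum_congr rfl fun e _ =>
      Finset.sum_congr rfl fun h _ => ?_
    ring

lemma belRobinsonMink_swap_left (W : Fin 4 → Fin 4 → Fin 4 → Fin 4 → ℝ) (a b l m : Fin 4) :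
    belRobinsonMink W a b l m = belRobinsonMink W b a l m := by
  rw [belRobinsonMink_eq, belRobinsonMink_eq, mink_comm b a]
  congr 1
  refine Finset.sum_congr rfl fun j _ => Finset.sum_congr rfl fun k _ => ?_
  ring

lemma belRobinsonMink_swap_right (W : Fin 4 → Fin 4 → Fin 4 → Fin 4 → ℝ) (a b l m : Fin 4) :
    belRobinsonMink W a b l m = belRobinsonMink W a b m l := by
  rw [belRobinsonMink_eq, belRobinsonMink_eq, mink_comm m l]
  congr 1
  refine Finset.sum_congr rfl fun j _ => Finset.sum_congr rfl fun k _ => ?_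
  ring

lemma spinorPairing_comm (M N : Matrix (Fin 2) (Fin 2) ℂ)
    (f : Fin 2 → Fin 2 → Fin 2 → Fin 2 → ℂ) :
    (spinorPairing M fun A A' => spinorPairing N fun B B' => f A A' B B') =
      spinorPairing N fun B B' => spinorPairing M fun A A' => f A A' B B' := by
  simp only [spinorPairing, Fin.sum_univ_two]
  ring

lemma spinorPairing_sum_smul {ι : Type*} [Fintype ι] (u : ι → ℂ)
    (M : ι → Matrix (Fin 2) (Fin 2) ℂ) (f : Fin 2 → Fin 2 → ℂ) :
    spinorPairing (∑ a, u a • M a) f = ∑ a, u a * spinorPairing (M a) f := by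
  simp only [spinorPairing, Fin.sum_univ_two, Matrix.sum_apply, Matrix.smul_apply, smul_eq_mul,
    Finset.sum_mul, ← Finset.sum_add_distrib]
  refine Finset.sum_congr rfl fun a _ => ?_
  ring

lemma spinorPairing_sum_mul {ι : Type*} [Fintype ι] (u : ι → ℂ)
    (M : Matrix (Fin 2) (Fin 2) ℂ) (f : ι → Fin 2 → Fin 2 → ℂ) :
    (spinorPairing M fun A A' => ∑ a, u a * f a A A') = ∑ a, u a * spinorPairing M (f a) := by
  simp only [spinorPairing, Fin.sum_univ_two, Finset.mul_sum, ← Finset.sum_add_distrib]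
  refine Finset.sum_congr rfl fun a _ => ?_
  ring

lemma spinorPairing_pauli_zero (f : Fin 2 → Fin 2 → ℂ) :
    spinorPairing (pauli 0) f = f 0 0 + f 1 1 := by
  simp [spinorPairing, pauli]

lemma spinorPairing_pauli_one (f : Fin 2 → Fin 2 → ℂ) :
    spinorPairing (pauli 1) f = f 0 1 + f 1 0 := by
  simp [spinorPairing, pauli]

lemma spinorPairing_pauli_two (f : Fin 2 → Fin 2 → ℂ) :
    spinorPairing (pauli 2) f = I * (f 1 0 - f 0 1) := by
  simp [spinorPairing, pauli]
  ring

lemma spinorPairing_pauli_three (f : Fin 2 → Fin 2 → ℂ) :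
    spinorPairing (pauli 3) f = f 0 0 - f 1 1 := by
  simp [spinorPairing, pauli]
  ring

lemma spinorEnergy_sum_smul {ι : Type*} [Fintype ι] (u₁ u₂ u₃ u₄ : ι → ℝ)
    (M : ι → Matrix (Fin 2) (Fin 2) ℂ) (Ψ : Fin 2 → Fin 2 → Fin 2 → Fin 2 → ℂ) :
    (spinorEnergy (∑ a, (u₁ a : ℂ) • M a) (∑ a, (u₂ a : ℂ) • M a) (∑ a, (u₃ a : ℂ) • M a)
      (∑ a, (u₄ a : ℂ) • M a) Ψ).re =
      ∑ a, ∑ b, ∑ c, ∑ d,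
        (spinorEnergy (M a) (M b) (M c) (M d) Ψ).re * u₁ a * u₂ b * u₃ c * u₄ d := by
  have h₄ (M₁ M₂ M₃ : Matrix (Fin 2) (Fin 2) ℂ) :
      spinorEnergy M₁ M₂ M₃ (∑ a, (u₄ a : ℂ) • M a) Ψ =
      ∑ d, u₄ d * spinorEnergy M₁ M₂ M₃ (M d) Ψ := by
    simp only [spinorEnergy, spinorPairing_sum_smul, spinorPairing_sum_mul]
  have h₃ (M₁ M₂ M₄ : Matrix (Fin 2) (Fin 2) ℂ) :
      spinorEnergy M₁ M₂ (∑ a, (u₃ a : ℂ) • M a) M₄ Ψ =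
      ∑ c, u₃ c * spinorEnergy M₁ M₂ (M c) M₄ Ψ := by
    simp only [spinorEnergy, spinorPairing_sum_smul, spinorPairing_sum_mul]
  have h₂ (M₁ M₃ M₄ : Matrix (Fin 2) (Fin 2) ℂ) :
      spinorEnergy M₁ (∑ a, (u₂ a : ℂ) • M a) M₃ M₄ Ψ =
      ∑ b, u₂ b * spinorEnergy M₁ (M b) M₃ M₄ Ψ := by
    simp only [spinorEnergy, spinorPairing_sum_smul, spinorPairing_sum_mul]
  have h₁ (M₂ M₃ M₄ : Matrix (Fin 2) (Fin 2) ℂ) :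
      spinorEnergy (∑ a, (u₁ a : ℂ) • M a) M₂ M₃ M₄ Ψ =
      ∑ a, u₁ a * spinorEnergy (M a) M₂ M₃ M₄ Ψ := by
    simp only [spinorEnergy, spinorPairing_sum_smul]
  rw [h₁, re_sum]
  refine Finset.sum_congr rfl fun a _ => ?_
  rw [re_ofReal_mul, h₂, re_sum, Finset.mul_sum]
  refine Finset.sum_congr rfl fun b _ => ?_
  rw [re_ofReal_mul, h₃, re_sum, Finset.mul_sum, Finset.mul_sum]
  refine Finset.sum_congr rfl fun c _ => ?_
  rw [re_ofReal_mul, h₄, re_sum, Finset.mul_sum, Finset.mul_sum, Finset.mul_sum]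
  refine Finset.sum_congr rfl fun d _ => ?_
  rw [re_ofReal_mul]
  ring

lemma spinorEnergy_weylSpinor_swap_left (W : Fin 4 → Fin 4 → Fin 4 → Fin 4 → ℝ)
    (M₁ M₂ M₃ M₄ : Matrix (Fin 2) (Fin 2) ℂ) :
    spinorEnergy M₁ M₂ M₃ M₄ (weylSpinor W) = spinorEnergy M₂ M₁ M₃ M₄ (weylSpinor W) := by
  have h : ∀ A B C D, weylSpinor W A B C D = weylSpinor W B A C D := fun A B C D => by
    rw [weylSpinor, weylSpinor, add_comm (A : ℕ) B]
  rw [spinorEnergy, spinorPairing_comm]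
  refine congrArg (spinorPairing M₂) (funext₂ fun B B' => congrArg (spinorPairing M₁)
    (funext₂ fun A A' => congrArg (spinorPairing M₃) (funext₂ fun C C' =>
      congrArg (spinorPairing M₄) (funext₂ fun D D' => ?_))))
  rw [h A, h A']

lemma spinorEnergy_weylSpinor_swap_right (W : Fin 4 → Fin 4 → Fin 4 → Fin 4 → ℝ)
    (M₁ M₂ M₃ M₄ : Matrix (Fin 2) (Fin 2) ℂ) :
    spinorEnergy M₁ M₂ M₃ M₄ (weylSpinor W) = spinorEnergy M₁ M₂ M₄ M₃ (weylSpinor W) := by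
  have h : ∀ A B C D, weylSpinor W A B C D = weylSpinor W A B D C := fun A B C D => by
    rw [weylSpinor, weylSpinor, add_right_comm]
  refine congrArg (spinorPairing M₁) (funext₂ fun A A' => congrArg (spinorPairing M₂)
    (funext₂ fun B B' => (spinorPairing_comm _ _ _).trans ?_))
  refine congrArg (spinorPairing M₄) (funext₂ fun D D' => congrArg (spinorPairing M₃)
    (funext₂ fun C C' => ?_))
  rw [h A B, h A' B']

/-- A future-directed timelike vector corresponds to a positive definite Hermitian matrix. -/
lemma pauli_posDef (u : Fin 4 → ℝ) (ht : ∑ a, ∑ b, mink a b * u a * u b < 0) (hf : 0 < u 0) :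
    (∑ a, (u a : ℂ) • pauli a).PosDef := by
  simp only [mul_assoc, sum_mink_mul, sum_mink_diag_mul] at ht
  have hpos : 0 < u 0 + u 3 := by nlinarith [sq_nonneg (u 1), sq_nonneg (u 2)]
  refine Matrix.PosDef.of_dotProduct_mulVec_pos ?_ fun x hx => ?_
  · ext i j
    fin_cases i <;> fin_cases j <;> simp [pauli, Fin.sum_univ_four]
  · have hform : star x ⬝ᵥ (∑ a, (u a : ℂ) • pauli a) *ᵥ x =
        ((((u 0 + u 3) * (x 0).re + u 1 * (x 1).re + u 2 * (x 1).im) ^ 2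
          + ((u 0 + u 3) * (x 0).im + u 1 * (x 1).im - u 2 * (x 1).re) ^ 2
          + (u 0 * u 0 - u 1 * u 1 - u 2 * u 2 - u 3 * u 3) * ((x 1).re ^ 2 + (x 1).im ^ 2))
          / (u 0 + u 3) : ℝ) := by
      apply Complex.ext
      · rw [ofReal_re, eq_div_iff hpos.ne']
        simp [dotProduct, mulVec, pauli, Fin.sum_univ_four]
        ring
      · rw [ofReal_im]
        simp [dotProduct, mulVec, pauli, Fin.sum_univ_four]
        ring
    rw [hform, zero_lt_real]
    refine div_pos ?_ hpos
    by_cases h1 : x 1 = 0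
    · have h0 : x 0 ≠ 0 := fun h0 => hx (by ext i; fin_cases i <;> simp [h0, h1])
      have := normSq_pos.2 h0
      rw [normSq_apply] at this
      simp only [h1, zero_re, zero_im]
      nlinarith [mul_pos (mul_pos hpos hpos) this]
    · have := normSq_pos.2 h1
      rw [normSq_apply] at this
      have := mul_pos (show 0 < u 0 * u 0 - u 1 * u 1 - u 2 * u 2 - u 3 * u 3 by linarith) this
      nlinarith [sq_nonneg ((u 0 + u 3) * (x 0).re + u 1 * (x 1).re + u 2 * (x 1).im),
        sq_nonneg ((u 0 + u 3) * (x 0).im + u 1 * (x 1).im - u 2 * (x 1).re)]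

lemma eq_zero_of_spinorEnergy_re_eq_zero {M₁ M₂ M₃ M₄ : Matrix (Fin 2) (Fin 2) ℂ}
    (h₁ : M₁.PosDef) (h₂ : M₂.PosDef) (h₃ : M₃.PosDef) (h₄ : M₄.PosDef)
    {Ψ : Fin 2 → Fin 2 → Fin 2 → Fin 2 → ℂ} (h : (spinorEnergy M₁ M₂ M₃ M₄ Ψ).re = 0) :
    Ψ = 0 := by
  have hpd := h₁.kronecker (h₂.kronecker (h₃.kronecker h₄))
  by_contra hne
  have hx : (fun p : Fin 2 × Fin 2 × Fin 2 × Fin 2 => Ψ p.1 p.2.1 p.2.2.1 p.2.2.2) ≠ 0 := by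
    intro h0
    apply hne
    funext A B C D
    exact congrFun h0 (A, B, C, D)
  refine (hpd.re_dotProduct_pos hx).ne' ?_
  rw [← h]
  change Complex.re _ = _
  congr 1
  simp only [spinorEnergy, spinorPairing, dotProduct, mulVec, Fintype.sum_prod_type,
    kroneckerMap_apply, Pi.star_apply, RCLike.star_def, Fin.sum_univ_two]
  ring

/-- Linear relations expressing every component of an array with Weyl symmetries through ten
independent ones. -/
structure WeylRelations (W : Fin 4 → Fin 4 → Fin 4 → Fin 4 → ℝ) : Prop where
  diag_left : ∀ a c d, W a a c d = 0
  diag_right : ∀ a b c, W a b c c = 0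
  antisymm_left_10 : ∀ c d, W 1 0 c d = -W 0 1 c d
  antisymm_left_20 : ∀ c d, W 2 0 c d = -W 0 2 c d
  antisymm_left_30 : ∀ c d, W 3 0 c d = -W 0 3 c d
  antisymm_left_21 : ∀ c d, W 2 1 c d = -W 1 2 c d
  antisymm_left_31 : ∀ c d, W 3 1 c d = -W 1 3 c d
  antisymm_left_32 : ∀ c d, W 3 2 c d = -W 2 3 c d
  antisymm_right_10 : ∀ a b, W a b 1 0 = -W a b 0 1
  antisymm_right_20 : ∀ a b, W a b 2 0 = -W a b 0 2
  antisymm_right_30 : ∀ a b, W a b 3 0 = -W a b 0 3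
  antisymm_right_21 : ∀ a b, W a b 2 1 = -W a b 1 2
  antisymm_right_31 : ∀ a b, W a b 3 1 = -W a b 1 3
  antisymm_right_32 : ∀ a b, W a b 3 2 = -W a b 2 3
  component_120i : ∀ i, W 1 2 0 i = W 0 i 1 2
  component_130i : ∀ i, W 1 3 0 i = W 0 i 1 3
  component_230i : ∀ i, W 2 3 0 i = W 0 i 2 3
  component_0201 : W 0 2 0 1 = W 0 1 0 2
  component_0301 : W 0 3 0 1 = W 0 1 0 3
  component_0302 : W 0 3 0 2 = W 0 2 0 3
  component_0303 : W 0 3 0 3 = -W 0 1 0 1 - W 0 2 0 2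
  component_0223 : W 0 2 2 3 = -W 0 1 1 3
  component_0323 : W 0 3 2 3 = W 0 1 1 2
  component_0313 : W 0 3 1 3 = -W 0 2 1 2
  component_0312 : W 0 3 1 2 = -W 0 1 2 3 + W 0 2 1 3
  component_1212 : W 1 2 1 2 = W 0 1 0 1 + W 0 2 0 2
  component_1313 : W 1 3 1 3 = -W 0 2 0 2
  component_2323 : W 2 3 2 3 = -W 0 1 0 1
  component_1213 : W 1 2 1 3 = W 0 2 0 3
  component_1223 : W 1 2 2 3 = -W 0 1 0 3
  component_1323 : W 1 3 2 3 = W 0 1 0 2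
  component_1312 : W 1 3 1 2 = W 0 2 0 3
  component_2312 : W 2 3 1 2 = -W 0 1 0 3
  component_2313 : W 2 3 1 3 = W 0 1 0 2

lemma weylRelations (W : Fin 4 → Fin 4 → Fin 4 → Fin 4 → ℝ)
    (hW1 : ∀ a b c d, W a b c d = - W b a c d)
    (hW2 : ∀ a b c d, W a b c d = - W a b d c)
    (hW3 : ∀ a b c d, W a b c d = W c d a b)
    (hW4 : ∀ a b c d, W a b c d + W a c d b + W a d b c = 0)
    (hWtr : ∀ b d, ∑ a, ∑ c, mink a c * W a b c d = 0) :
    WeylRelations W := by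
  have hd1 : ∀ a c d, W a a c d = 0 := fun a c d => by linarith [hW1 a a c d]
  have hd2 : ∀ a b c, W a b c c = 0 := fun a b c => by linarith [hW2 a b c c]
  simp only [sum_mink_mul, sum_mink_diag_mul] at hWtr
  have f10 := hW1 1 0
  have f20 := hW1 2 0
  have f30 := hW1 3 0
  have f21 := hW1 2 1
  have f31 := hW1 3 1
  have f32 := hW1 3 2
  have s10 := fun a b => hW2 a b 1 0
  have s20 := fun a b => hW2 a b 2 0
  have s30 := fun a b => hW2 a b 3 0
  have s21 := fun a b => hW2 a b 2 1
  have s31 := fun a b => hW2 a b 3 1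
  have s32 := fun a b => hW2 a b 3 2
  have t1 : ∀ i, W 1 2 0 i = W 0 i 1 2 := fun i => hW3 _ _ _ _
  have t2 : ∀ i, W 1 3 0 i = W 0 i 1 3 := fun i => hW3 _ _ _ _
  have t3 : ∀ i, W 2 3 0 i = W 0 i 2 3 := fun i => hW3 _ _ _ _
  have e21 : W 0 2 0 1 = W 0 1 0 2 := hW3 _ _ _ _
  have e31 : W 0 3 0 1 = W 0 1 0 3 := hW3 _ _ _ _
  have e32 : W 0 3 0 2 = W 0 2 0 3 := hW3 _ _ _ _
  have r00 := hWtr 0 0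
  have r01 := hWtr 0 1
  have r02 := hWtr 0 2
  have r03 := hWtr 0 3
  have r11 := hWtr 1 1
  have r12 := hWtr 1 2
  have r13 := hWtr 1 3
  have r22 := hWtr 2 2
  have r23 := hWtr 2 3
  have r33 := hWtr 3 3
  have r0123 := hW4 0 1 2 3
  simp only [hd1, hd2, f10, f20, f30, f21, f31, f32, s10, s20, s30, s21, s31, s32]
    at r00 r01 r02 r03 r11 r12 r13 r22 r23 r33 r0123
  have e33 : W 0 3 0 3 = -W 0 1 0 1 - W 0 2 0 2 := by linarith
  have h21 : W 0 2 2 3 = -W 0 1 1 3 := by linarith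
  have h31 : W 0 3 2 3 = W 0 1 1 2 := by linarith
  have h32 : W 0 3 1 3 = -W 0 2 1 2 := by linarith
  have h33 : W 0 3 1 2 = -W 0 1 2 3 + W 0 2 1 3 := by linarith
  have p11 : W 1 2 1 2 = W 0 1 0 1 + W 0 2 0 2 := by linarith
  have p22 : W 1 3 1 3 = -W 0 2 0 2 := by linarith
  have p33 : W 2 3 2 3 = -W 0 1 0 1 := by linarith
  have p12 : W 1 2 1 3 = W 0 2 0 3 := by linarith
  have p13 : W 1 2 2 3 = -W 0 1 0 3 := by linarith
  have p23 : W 1 3 2 3 = W 0 1 0 2 := by linarith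
  have p21 : W 1 3 1 2 = W 0 2 0 3 := by rw [hW3, p12]
  have p31 : W 2 3 1 2 = -W 0 1 0 3 := by rw [hW3, p13]
  have p32 : W 2 3 1 3 = W 0 1 0 2 := by rw [hW3, p23]
  exact ⟨hd1, hd2, f10, f20, f30, f21, f31, f32, s10, s20, s30, s21, s31, s32, t1, t2, t3, e21, e31,
    e32, e33, h21, h31, h32, h33, p11, p22, p33, p12, p13, p23, p21, p31, p32⟩

lemma WeylRelations.sum_sq {W : Fin 4 → Fin 4 → Fin 4 → Fin 4 → ℝ} (hW : WeylRelations W) :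
    ∑ d, ∑ f, ∑ e, ∑ h, mink d d * mink f f * mink e e * mink h h * W d f e h ^ 2 =
      16 * (W 0 1 0 1 ^ 2 + W 0 2 0 2 ^ 2 + W 0 1 0 1 * W 0 2 0 2 + W 0 1 0 2 ^ 2 + W 0 1 0 3 ^ 2
       + W 0 2 0 3 ^ 2 - W 0 1 2 3 ^ 2 - W 0 2 1 3 ^ 2 + W 0 1 2 3 * W 0 2 1 3 - W 0 1 1 3 ^ 2
       - W 0 1 1 2 ^ 2 - W 0 2 1 2 ^ 2) := by
  simp only [mul_assoc, ← Finset.mul_sum, sum_mink_diag_mul,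
    hW.diag_left, hW.diag_right, hW.antisymm_left_10, hW.antisymm_left_20, hW.antisymm_left_30,
    hW.antisymm_left_21, hW.antisymm_left_31, hW.antisymm_left_32, hW.antisymm_right_10,
    hW.antisymm_right_20, hW.antisymm_right_30, hW.antisymm_right_21, hW.antisymm_right_31,
    hW.antisymm_right_32, hW.component_120i, hW.component_130i, hW.component_230i,
    hW.component_0201, hW.component_0301, hW.component_0302, hW.component_0303, hW.component_0223,
    hW.component_0323, hW.component_0313, hW.component_0312, hW.component_1212, hW.component_1313,
    hW.component_2323, hW.component_1213, hW.component_1223, hW.component_1323, hW.component_1312,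
    hW.component_2312, hW.component_2313]
  ring

set_option linter.unusedSimpArgs false in
set_option maxHeartbeats 4000000 in
lemma WeylRelations.belRobinsonMink_eq_spinorEnergy_of_le
    {W : Fin 4 → Fin 4 → Fin 4 → Fin 4 → ℝ} (hW : WeylRelations W) {a b c d : Fin 4}
    (hab : a ≤ b) (hcd : c ≤ d) :
    4 * belRobinsonMink W a b c d =
      (spinorEnergy (pauli a) (pauli b) (pauli c) (pauli d) (weylSpinor W)).re := by
  have I_mul_re (z : ℂ) : (I * z).re = -z.im := by simp
  have I_mul_im (z : ℂ) : (I * z).im = z.re := by simp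
  have conj_mul_re (z w : ℂ) : (conj z * w).re = z.re * w.re + z.im * w.im := by simp
  have conj_mul_im (z w : ℂ) : (conj z * w).im = z.re * w.im - z.im * w.re := by
    simp
    ring
  have z0000 : weylSpinor W 0 0 0 0 = weylScalar W 0 := rfl
  have z0001 : weylSpinor W 0 0 0 1 = weylScalar W 1 := rfl
  have z0010 : weylSpinor W 0 0 1 0 = weylScalar W 1 := rfl
  have z0011 : weylSpinor W 0 0 1 1 = weylScalar W 2 := rfl
  have z0100 : weylSpinor W 0 1 0 0 = weylScalar W 1 := rfl
  have z0101 : weylSpinor W 0 1 0 1 = weylScalar W 2 := rfl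
  have z0110 : weylSpinor W 0 1 1 0 = weylScalar W 2 := rfl
  have z0111 : weylSpinor W 0 1 1 1 = weylScalar W 3 := rfl
  have z1000 : weylSpinor W 1 0 0 0 = weylScalar W 1 := rfl
  have z1001 : weylSpinor W 1 0 0 1 = weylScalar W 2 := rfl
  have z1010 : weylSpinor W 1 0 1 0 = weylScalar W 2 := rfl
  have z1011 : weylSpinor W 1 0 1 1 = weylScalar W 3 := rfl
  have z1100 : weylSpinor W 1 1 0 0 = weylScalar W 2 := rfl
  have z1101 : weylSpinor W 1 1 0 1 = weylScalar W 3 := rfl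
  have z1110 : weylSpinor W 1 1 1 0 = weylScalar W 3 := rfl
  have z1111 : weylSpinor W 1 1 1 1 = weylScalar W 4 := rfl
  have m00 : mink 0 0 = -1 := mink_zero
  have m01 : mink 0 1 = 0 := mink_of_ne (by decide)
  have m02 : mink 0 2 = 0 := mink_of_ne (by decide)
  have m03 : mink 0 3 = 0 := mink_of_ne (by decide)
  have m11 : mink 1 1 = 1 := mink_self (by decide)
  have m12 : mink 1 2 = 0 := mink_of_ne (by decide)
  have m13 : mink 1 3 = 0 := mink_of_ne (by decide)
  have m22 : mink 2 2 = 1 := mink_self (by decide)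
  have m23 : mink 2 3 = 0 := mink_of_ne (by decide)
  have m33 : mink 3 3 = 1 := mink_self (by decide)
  rw [belRobinsonMink_eq, hW.sum_sq]
  simp only [mul_assoc, ← Finset.mul_sum, sum_mink_diag_mul, spinorEnergy]
  rcases fin_four_cases a with rfl | rfl | rfl | rfl <;>
  rcases fin_four_cases b with rfl | rfl | rfl | rfl <;>
  first
  | (exfalso; revert hab; decide)
  | (simp only [
      spinorPairing_pauli_zero, spinorPairing_pauli_one, spinorPairing_pauli_two,
      spinorPairing_pauli_three, hW.diag_left, hW.antisymm_left_10, hW.antisymm_left_20,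
      hW.antisymm_left_30, hW.antisymm_left_21, hW.antisymm_left_31, hW.antisymm_left_32, m00,
      m01, m02, m03, m11, m12, m13, m22, m23, m33, zero_mul, mul_zero, sub_zero, zero_add,
      add_zero, neg_zero, neg_mul, mul_neg, neg_neg, one_mul]
     rcases fin_four_cases c with rfl | rfl | rfl | rfl <;>
     rcases fin_four_cases d with rfl | rfl | rfl | rfl <;>
     first
     | (exfalso; revert hcd; decide)
     | (simp only [
          hW.diag_right, hW.antisymm_right_10, hW.antisymm_right_20, hW.antisymm_right_30,
          hW.antisymm_right_21,
          hW.antisymm_right_31, hW.antisymm_right_32, hW.component_120i, hW.component_130i,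
          hW.component_230i, hW.component_0201, hW.component_0301, hW.component_0302,
          hW.component_0303, hW.component_0223, hW.component_0323, hW.component_0313,
          hW.component_0312, hW.component_1212, hW.component_1313, hW.component_2323,
          hW.component_1213, hW.component_1223, hW.component_1323, hW.component_1312,
          hW.component_2312, hW.component_2313, spinorPairing_pauli_zero, spinorPairing_pauli_one,
          spinorPairing_pauli_two, spinorPairing_pauli_three, m00, m01, m02, m03, m11, m12, m13,
          m22, m23, m33, z0000, z0001, z0010, z0011, z0100, z0101, z0110, z0111, z1000, z1001,
          z1010, z1011, z1100, z1101, z1110, z1111, I_mul_re, I_mul_im, conj_mul_re, conj_mul_im,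
          add_re, add_im, sub_re, sub_im, weylScalar, zero_mul, mul_zero, sub_zero, zero_add,
          add_zero, neg_zero, neg_mul, mul_neg, neg_neg, one_mul]
        ring))

lemma WeylRelations.belRobinsonMink_eq_spinorEnergy
    {W : Fin 4 → Fin 4 → Fin 4 → Fin 4 → ℝ} (hW : WeylRelations W) (a b c d : Fin 4) :
    4 * belRobinsonMink W a b c d =
      (spinorEnergy (pauli a) (pauli b) (pauli c) (pauli d) (weylSpinor W)).re := by
  rcases le_total a b with hab | hab <;> rcases le_total c d with hcd | hcd
  · exact hW.belRobinsonMink_eq_spinorEnergy_of_le hab hcd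
  · rw [belRobinsonMink_swap_right, spinorEnergy_weylSpinor_swap_right]
    exact hW.belRobinsonMink_eq_spinorEnergy_of_le hab hcd
  · rw [belRobinsonMink_swap_left, spinorEnergy_weylSpinor_swap_left]
    exact hW.belRobinsonMink_eq_spinorEnergy_of_le hab hcd
  · rw [belRobinsonMink_swap_left, spinorEnergy_weylSpinor_swap_left, belRobinsonMink_swap_right,
      spinorEnergy_weylSpinor_swap_right]
    exact hW.belRobinsonMink_eq_spinorEnergy_of_le hab hcd

set_option linter.unusedSimpArgs false in
lemma WeylRelations.eq_zero_of_weylSpinor_eq_zero {W : Fin 4 → Fin 4 → Fin 4 → Fin 4 → ℝ}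
    (hW : WeylRelations W) (h : weylSpinor W = 0) (a b c d : Fin 4) : W a b c d = 0 := by
  have h0 : weylScalar W 0 = 0 := congrFun (congrFun (congrFun (congrFun h 0) 0) 0) 0
  have h1 : weylScalar W 1 = 0 := congrFun (congrFun (congrFun (congrFun h 0) 0) 0) 1
  have h2 : weylScalar W 2 = 0 := congrFun (congrFun (congrFun (congrFun h 0) 0) 1) 1
  have h3 : weylScalar W 3 = 0 := congrFun (congrFun (congrFun (congrFun h 0) 1) 1) 1
  have h4 : weylScalar W 4 = 0 := congrFun (congrFun (congrFun (congrFun h 1) 1) 1) 1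
  simp only [weylScalar, Complex.ext_iff, zero_re, zero_im] at h0 h1 h2 h3 h4
  have c0101 : W 0 1 0 1 = 0 := by linarith
  have c0102 : W 0 1 0 2 = 0 := by linarith
  have c0103 : W 0 1 0 3 = 0 := by linarith
  have c0202 : W 0 2 0 2 = 0 := by linarith
  have c0203 : W 0 2 0 3 = 0 := by linarith
  have c0112 : W 0 1 1 2 = 0 := by linarith
  have c0113 : W 0 1 1 3 = 0 := by linarith
  have c0123 : W 0 1 2 3 = 0 := by linarith
  have c0212 : W 0 2 1 2 = 0 := by linarith
  have c0213 : W 0 2 1 3 = 0 := by linarith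
  rcases fin_four_cases a with rfl | rfl | rfl | rfl <;>
  rcases fin_four_cases b with rfl | rfl | rfl | rfl <;>
  rcases fin_four_cases c with rfl | rfl | rfl | rfl <;>
  rcases fin_four_cases d with rfl | rfl | rfl | rfl <;>
  simp only [
    hW.diag_left, hW.diag_right, hW.antisymm_left_10, hW.antisymm_left_20, hW.antisymm_left_30,
    hW.antisymm_left_21, hW.antisymm_left_31, hW.antisymm_left_32, hW.antisymm_right_10,
    hW.antisymm_right_20, hW.antisymm_right_30, hW.antisymm_right_21, hW.antisymm_right_31,
    hW.antisymm_right_32, hW.component_120i, hW.component_130i, hW.component_230i,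
    hW.component_0201, hW.component_0301, hW.component_0302, hW.component_0303, hW.component_0223,
    hW.component_0323, hW.component_0313, hW.component_0312, hW.component_1212, hW.component_1313,
    hW.component_2323, hW.component_1213, hW.component_1223, hW.component_1323, hW.component_1312,
    hW.component_2312, hW.component_2313, c0101, c0102, c0103, c0202, c0203, c0112, c0113, c0123,
    c0212, c0213, neg_zero, add_zero, sub_zero]

end BelRobinsonSpinor

/-- If the superenergy density computed with four timelike future-directed vectors
vanishes, then the Weyl-type tensor `W` vanishes. -/
theorem belRobinson_superenergy_zero_iff_weyl_zero
    (W : Fin 4 → Fin 4 → Fin 4 → Fin 4 → ℝ)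
    (hW1 : ∀ a b c d, W a b c d = - W b a c d)
    (hW2 : ∀ a b c d, W a b c d = - W a b d c)
    (hW3 : ∀ a b c d, W a b c d = W c d a b)
    (hW4 : ∀ a b c d, W a b c d + W a c d b + W a d b c = 0)
    (hWtr : ∀ b d, ∑ a, ∑ c, mink a c * W a b c d = 0)
    (u₁ u₂ u₃ u₄ : Fin 4 → ℝ)
    (ht₁ : ∑ a, ∑ b, mink a b * u₁ a * u₁ b < 0) (hf₁ : 0 < u₁ 0)
    (ht₂ : ∑ a, ∑ b, mink a b * u₂ a * u₂ b < 0) (hf₂ : 0 < u₂ 0)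
    (ht₃ : ∑ a, ∑ b, mink a b * u₃ a * u₃ b < 0) (hf₃ : 0 < u₃ 0)
    (ht₄ : ∑ a, ∑ b, mink a b * u₄ a * u₄ b < 0) (hf₄ : 0 < u₄ 0)
    (hzero : ∑ a, ∑ b, ∑ c, ∑ d,
        belRobinsonMink W a b c d * u₁ a * u₂ b * u₃ c * u₄ d = 0) :
    ∀ a b c d, W a b c d = 0 := by
  have hW := weylRelations W hW1 hW2 hW3 hW4 hWtr
  refine hW.eq_zero_of_weylSpinor_eq_zero (eq_zero_of_spinorEnergy_re_eq_zero
    (pauli_posDef u₁ ht₁ hf₁) (pauli_posDef u₂ ht₂ hf₂) (pauli_posDef u₃ ht₃ hf₃)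
    (pauli_posDef u₄ ht₄ hf₄) ?_)
  simp only [spinorEnergy_sum_smul, ← hW.belRobinsonMink_eq_spinorEnergy, mul_assoc,
    ← Finset.mul_sum] at hzero ⊢
  rw [hzero, mul_zero]
end
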